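/- Let L be a linear hyperplane in R^d, A and B convex bodies with maximal section volumes (parallel to L) both equal to 1, and α, β > 0 with α + β = 1. Then equality μ_d(αA + βB) = α μ_d(A) + β μ_d(B) holds in the Bonnesen inequality for sections if and only if either A and B are homothetic, or there exist a unit vector v, homothetic convex bodies A' and B', and a hyperplane H parallel to L such that π_v(A') = π_v(A' ∩ H), and A and B are obtained from A' and B' respectively by stretching along v. -/

import Mathlib

open MeasureTheory Pointwise
open scoped RealInnerProductSpace

/-- The `(d-1)`-volume of the section of `K` at height `p` in direction `u`. -/
noncomputable def sectionVol (d : ℕ) (K : Set (EuclideanSpace ℝ (Fin d)))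
    (u : EuclideanSpace ℝ (Fin d)) (p : ℝ) : ℝ :=
  (μH[(d : ℝ) - 1] (K ∩ {x | ⟪x, u⟫ = p})).toReal

/-- `A` and `B` are homothetic: one is a translate of a positive dilate of the
other. -/
def Homothetic {d : ℕ} (A B : Set (EuclideanSpace ℝ (Fin d))) : Prop :=
  ∃ r : ℝ, 0 < r ∧ ∃ x : EuclideanSpace ℝ (Fin d), B = x +ᵥ r • A

/-- `K` is obtained from `C` by stretching along the unit vector `v`:
`K = C + [w, w + λv]` for some `λ ≥ 0` and `w`. -/
def StretchOf {d : ℕ} (K C : Set (EuclideanSpace ℝ (Fin d)))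
    (v : EuclideanSpace ℝ (Fin d)) : Prop :=
  ∃ lam : ℝ, 0 ≤ lam ∧ ∃ w : EuclideanSpace ℝ (Fin d),
    K = C + segment ℝ w (w + lam • v)

namespace BonnesenSections

open Set Filter Topology Module

/-! ### One-dimensional inequalities -/

theorem volume_add_volume_le {S T : Set ℝ} (hS : IsCompact S) (hT : IsCompact T)
    (hS' : S.Nonempty) (hT' : T.Nonempty) :
    volume S + volume T ≤ volume (S + T) := by
  obtain ⟨s, hs, hsmax⟩ := hS.exists_isGreatest hS'
  obtain ⟨t, ht, htmin⟩ := hT.exists_isLeast hT'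
  have hsub : (t +ᵥ S) ∪ (s +ᵥ T) ⊆ S + T := by
    rintro _ (⟨x, hx, rfl⟩ | ⟨x, hx, rfl⟩)
    · exact ⟨x, hx, t, ht, add_comm _ _⟩
    · exact ⟨s, hs, x, hx, rfl⟩
  have hdisj : AEDisjoint volume (t +ᵥ S) (s +ᵥ T) := by
    refine measure_mono_null (t := {s + t}) ?_ (by simp)
    rintro _ ⟨⟨x, hx, rfl⟩, ⟨y, hy, hxy⟩⟩
    have h1 := hsmax hx
    have h2 := htmin hy
    simp only [vadd_eq_add, mem_singleton_iff] at *
    linarith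
  calc volume S + volume T = volume (t +ᵥ S) + volume (s +ᵥ T) := by
        rw [measure_vadd, measure_vadd]
    _ = volume ((t +ᵥ S) ∪ (s +ᵥ T)) :=
        (measure_union₀ (hT.vadd s).measurableSet.nullMeasurableSet hdisj).symm
    _ ≤ _ := measure_mono hsub

theorem weighted_volume_le {S T U : Set ℝ} (hS : IsCompact S) (hT : IsCompact T)
    (hS' : S.Nonempty) (hT' : T.Nonempty) {α β : ℝ} (hα : 0 < α) (hβ : 0 < β)
    (hU : ∀ p ∈ S, ∀ q ∈ T, α * p + β * q ∈ U) :
    ENNReal.ofReal α * volume S + ENNReal.ofReal β * volume T ≤ volume U := by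
  have h := volume_add_volume_le (hS.smul α) (hT.smul β) hS'.smul_set hT'.smul_set
  rw [Measure.addHaar_smul, Measure.addHaar_smul] at h
  simp only [finrank_self, pow_one, abs_of_pos hα, abs_of_pos hβ] at h
  refine h.trans (measure_mono ?_)
  rintro _ ⟨_, ⟨p, hp, rfl⟩, _, ⟨q, hq, rfl⟩, rfl⟩
  exact hU p hp q hq

section Superlevel

variable {f g h : ℝ → ℝ} {α β : ℝ}

theorem superlevel_volume_le (hα : 0 < α) (hβ : 0 < β)
    (hfc : ∀ t > 0, IsCompact {p | t ≤ f p}) (hgc : ∀ t > 0, IsCompact {p | t ≤ g p})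
    (hf1 : IsGreatest (range f) 1) (hg1 : IsGreatest (range g) 1)
    (hh : ∀ p q, min (f p) (g q) ≤ h (α * p + β * q)) {t : ℝ} (ht : 0 < t) (ht1 : t ≠ 1) :
    ENNReal.ofReal α * volume {p | t ≤ f p} + ENNReal.ofReal β * volume {p | t ≤ g p} ≤
      volume {p | t ≤ h p} := by
  obtain ⟨⟨p₁, hp₁⟩, hf1⟩ := hf1
  obtain ⟨⟨q₁, hq₁⟩, hg1⟩ := hg1
  rcases ht1.lt_or_gt with h1 | h1
  · refine weighted_volume_le (hfc t ht) (hgc t ht) ⟨p₁, ?_⟩ ⟨q₁, ?_⟩ hα hβ ?_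
    · simp [hp₁, h1.le]
    · simp [hq₁, h1.le]
    · intro p hp q hq
      exact (le_min hp hq).trans (hh p q)
  · have e1 : {p | t ≤ f p} = ∅ := by
      ext p; simpa using (hf1 ⟨p, rfl⟩).trans_lt h1
    have e2 : {p | t ≤ g p} = ∅ := by
      ext p; simpa using (hg1 ⟨p, rfl⟩).trans_lt h1
    simp [e1, e2]

theorem measurable_volume_superlevel (f : ℝ → ℝ) : Measurable fun t => volume {p | t ≤ f p} := by
  refine Antitone.measurable fun s t hst => measure_mono fun p hp => ?_
  exact hst.trans hp

theorem lintegral_superlevel_eq (hf0 : ∀ p, 0 ≤ f p) (hg0 : ∀ p, 0 ≤ g p)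
    (hfm : Measurable f) (hgm : Measurable g) :
    ENNReal.ofReal α * (∫⁻ p, ENNReal.ofReal (f p)) +
      ENNReal.ofReal β * (∫⁻ p, ENNReal.ofReal (g p)) =
      ∫⁻ t in Ioi (0 : ℝ), (ENNReal.ofReal α * volume {p | t ≤ f p} +
        ENNReal.ofReal β * volume {p | t ≤ g p}) := by
  rw [lintegral_add_left ((measurable_volume_superlevel f).const_mul _),
    lintegral_const_mul _ (measurable_volume_superlevel f),
    lintegral_const_mul _ (measurable_volume_superlevel g),
    lintegral_eq_lintegral_meas_le volume (ae_of_all _ hf0) hfm.aemeasurable,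
    lintegral_eq_lintegral_meas_le volume (ae_of_all _ hg0) hgm.aemeasurable]

theorem ae_superlevel_volume_le (hα : 0 < α) (hβ : 0 < β)
    (hfc : ∀ t > 0, IsCompact {p | t ≤ f p}) (hgc : ∀ t > 0, IsCompact {p | t ≤ g p})
    (hf1 : IsGreatest (range f) 1) (hg1 : IsGreatest (range g) 1)
    (hh : ∀ p q, min (f p) (g q) ≤ h (α * p + β * q)) :
    (fun t => ENNReal.ofReal α * volume {p | t ≤ f p} + ENNReal.ofReal β * volume {p | t ≤ g p})
      ≤ᵐ[volume.restrict (Ioi (0 : ℝ))] fun t => volume {p | t ≤ h p} := by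
  have hne : ∀ᵐ t : ℝ ∂volume.restrict (Ioi 0), t ≠ 1 :=
    ae_restrict_of_ae (Measure.ae_ne volume 1)
  filter_upwards [hne, ae_restrict_mem measurableSet_Ioi] with t ht1 ht
  exact superlevel_volume_le hα hβ hfc hgc hf1 hg1 hh ht ht1

theorem lintegral_le_of_superlevel (hα : 0 < α) (hβ : 0 < β)
    (hf0 : ∀ p, 0 ≤ f p) (hg0 : ∀ p, 0 ≤ g p) (hh0 : ∀ p, 0 ≤ h p)
    (hfm : Measurable f) (hgm : Measurable g) (hhm : Measurable h)
    (hfc : ∀ t > 0, IsCompact {p | t ≤ f p}) (hgc : ∀ t > 0, IsCompact {p | t ≤ g p})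
    (hf1 : IsGreatest (range f) 1) (hg1 : IsGreatest (range g) 1)
    (hh : ∀ p q, min (f p) (g q) ≤ h (α * p + β * q)) :
    ENNReal.ofReal α * (∫⁻ p, ENNReal.ofReal (f p)) +
      ENNReal.ofReal β * (∫⁻ p, ENNReal.ofReal (g p)) ≤
      ∫⁻ p, ENNReal.ofReal (h p) := by
  rw [lintegral_superlevel_eq hf0 hg0 hfm hgm,
    lintegral_eq_lintegral_meas_le volume (ae_of_all _ hh0) hhm.aemeasurable]
  exact lintegral_mono_ae (ae_superlevel_volume_le hα hβ hfc hgc hf1 hg1 hh)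

theorem ae_superlevel_volume_eq (hα : 0 < α) (hβ : 0 < β)
    (hf0 : ∀ p, 0 ≤ f p) (hg0 : ∀ p, 0 ≤ g p) (hh0 : ∀ p, 0 ≤ h p)
    (hfm : Measurable f) (hgm : Measurable g) (hhm : Measurable h)
    (hfc : ∀ t > 0, IsCompact {p | t ≤ f p}) (hgc : ∀ t > 0, IsCompact {p | t ≤ g p})
    (hf1 : IsGreatest (range f) 1) (hg1 : IsGreatest (range g) 1)
    (hh : ∀ p q, min (f p) (g q) ≤ h (α * p + β * q))
    (hfin : ∫⁻ p, ENNReal.ofReal (h p) ≠ ⊤)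
    (heq : ∫⁻ p, ENNReal.ofReal (h p) ≤
      ENNReal.ofReal α * (∫⁻ p, ENNReal.ofReal (f p)) +
        ENNReal.ofReal β * (∫⁻ p, ENNReal.ofReal (g p))) :
    ∀ᵐ t ∂volume.restrict (Ioi (0 : ℝ)), ENNReal.ofReal α * volume {p | t ≤ f p} +
      ENNReal.ofReal β * volume {p | t ≤ g p} = volume {p | t ≤ h p} := by
  rw [lintegral_superlevel_eq hf0 hg0 hfm hgm,
    lintegral_eq_lintegral_meas_le volume (ae_of_all _ hh0) hhm.aemeasurable] at heq
  rw [lintegral_eq_lintegral_meas_le volume (ae_of_all _ hh0) hhm.aemeasurable] at hfin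
  have hle := ae_superlevel_volume_le hα hβ hfc hgc hf1 hg1 hh
  exact ae_eq_of_ae_le_of_lintegral_le hle (ne_top_of_le_ne_top hfin (lintegral_mono_ae hle))
    (measurable_volume_superlevel h).aemeasurable heq

end Superlevel

/-! ### Slices of compact sets -/

/-- The slice of `S ⊆ ℝ × E` at height `p`. -/
def slice {E : Type*} (S : Set (ℝ × E)) (p : ℝ) : Set E := Prod.mk p ⁻¹' S

@[simp] theorem mem_slice {E : Type*} {S : Set (ℝ × E)} {p : ℝ} {y : E} :
    y ∈ slice S p ↔ (p, y) ∈ S := Iff.rfl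

theorem slice_nonempty_of_pos {E : Type*} [MeasurableSpace E] {μ : Measure E} {S : Set (ℝ × E)}
    {p : ℝ} (h : 0 < μ.real (slice S p)) : (slice S p).Nonempty := by
  by_contra hne
  rw [not_nonempty_iff_eq_empty] at hne
  simp [hne] at h

theorem slice_add_subset {E : Type*} [AddCommGroup E] [Module ℝ E] {K L : Set (ℝ × E)} {α β : ℝ}
    (p q : ℝ) : α • slice K p + β • slice L q ⊆ slice (α • K + β • L) (α * p + β * q) := by
  rintro _ ⟨_, ⟨x, hx, rfl⟩, _, ⟨y, hy, rfl⟩, rfl⟩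
  exact ⟨_, ⟨_, hx, rfl⟩, _, ⟨_, hy, rfl⟩, by simp⟩

theorem isCompact_slice {E : Type*} [NormedAddCommGroup E] {S : Set (ℝ × E)} (hS : IsCompact S)
    (p : ℝ) : IsCompact (slice S p) := by
  refine (hS.image continuous_snd).of_isClosed_subset
    (hS.isClosed.preimage (Continuous.prodMk_right p)) ?_
  intro y hy
  exact ⟨(p, y), hy, rfl⟩

section Slice

variable {E : Type*} [NormedAddCommGroup E] [MeasurableSpace E] {μ : Measure E} {S : Set (ℝ × E)}

theorem upperSemicontinuous_slice [IsFiniteMeasureOnCompacts μ] [μ.OuterRegular]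
    (hS : IsCompact S) : UpperSemicontinuous fun p => μ.real (slice S p) := by
  intro p t hp
  have hfin : μ (slice S p) ≠ ⊤ := (isCompact_slice hS p).measure_ne_top
  have hlt : μ (slice S p) < ENNReal.ofReal t := by
    rwa [ENNReal.lt_ofReal_iff_toReal_lt hfin]
  obtain ⟨V, hV, hVo, hVt⟩ := Set.exists_isOpen_lt_of_lt _ _ hlt
  have hcl : IsClosed (Prod.fst '' (S ∩ Prod.snd ⁻¹' Vᶜ)) :=
    ((hS.inter_right (hVo.isClosed_compl.preimage continuous_snd)).image continuous_fst).isClosed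
  have hmem : p ∈ (Prod.fst '' (S ∩ Prod.snd ⁻¹' Vᶜ))ᶜ := by
    rintro ⟨⟨_, y⟩, ⟨hy, hyV⟩, rfl⟩
    exact hyV (hV hy)
  filter_upwards [hcl.isOpen_compl.mem_nhds hmem] with q hq
  have hsub : slice S q ⊆ V := fun y hy => by
    by_contra hyV
    exact hq ⟨(q, y), ⟨hy, hyV⟩, rfl⟩
  rw [Measure.real, ← ENNReal.lt_ofReal_iff_toReal_lt (isCompact_slice hS q).measure_ne_top]
  exact (measure_mono hsub).trans_lt hVt

theorem isCompact_superlevel_slice [IsFiniteMeasureOnCompacts μ] [μ.OuterRegular]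
    (hS : IsCompact S) {t : ℝ} (ht : 0 < t) : IsCompact {p | t ≤ μ.real (slice S p)} := by
  refine (hS.image continuous_fst).of_isClosed_subset
    ((upperSemicontinuous_slice hS).isClosed_preimage t) ?_
  intro p hp
  obtain ⟨y, hy⟩ := slice_nonempty_of_pos (ht.trans_le hp)
  exact ⟨(p, y), hy, rfl⟩

theorem exists_slice_max [IsFiniteMeasureOnCompacts μ] [μ.OuterRegular]
    (hS : IsCompact S) (hne : S.Nonempty) :
    ∃ p₀, ∀ p, μ.real (slice S p) ≤ μ.real (slice S p₀) := by
  obtain ⟨p₀, -, hp₀⟩ := UpperSemicontinuousOn.exists_isMaxOn (hne.image Prod.fst)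
    (hS.image continuous_fst) ((upperSemicontinuous_slice (μ := μ) hS).upperSemicontinuousOn _)
  refine ⟨p₀, fun p => ?_⟩
  rcases (measureReal_nonneg : 0 ≤ μ.real (slice S p)).eq_or_lt with h | h
  · rw [← h]; exact measureReal_nonneg
  · obtain ⟨y, hy⟩ := slice_nonempty_of_pos h
    exact hp₀ ⟨(p, y), hy, rfl⟩

theorem measurable_slice [IsFiniteMeasureOnCompacts μ] [μ.OuterRegular]
    (hS : IsCompact S) : Measurable fun p => μ.real (slice S p) :=
  (upperSemicontinuous_slice hS).measurable

theorem lintegral_slice [BorelSpace E] [SecondCountableTopology E] [SFinite μ]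
    [IsFiniteMeasureOnCompacts μ] (hS : IsCompact S) :
    ∫⁻ p, ENNReal.ofReal (μ.real (slice S p)) = (volume.prod μ) S := by
  rw [Measure.prod_apply hS.measurableSet]
  refine lintegral_congr fun p => ?_
  exact ENNReal.ofReal_toReal (isCompact_slice hS p).measure_ne_top

end Slice

/-! ### The Brunn-Minkowski inequality -/

/-- The multiplicative form of the Brunn-Minkowski inequality for a measure. -/
def MulBrunnMinkowski {E : Type*} [NormedAddCommGroup E] [NormedSpace ℝ E] [MeasurableSpace E]
    (μ : Measure E) : Prop :=
  ∀ ⦃K L : Set E⦄, IsCompact K → IsCompact L → K.Nonempty → L.Nonempty →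
    ∀ ⦃α β : ℝ⦄, 0 < α → 0 < β → α + β = 1 →
      μ.real K ^ α * μ.real L ^ β ≤ μ.real (α • K + β • L)

theorem min_le_rpow_mul_rpow {x y α β : ℝ} (hx : 0 ≤ x) (hy : 0 ≤ y) (hα : 0 < α) (hβ : 0 < β)
    (hαβ : α + β = 1) : min x y ≤ x ^ α * y ^ β := by
  have hm : 0 ≤ min x y := le_min hx hy
  calc min x y = min x y ^ α * min x y ^ β := by
        rw [← Real.rpow_add' hm (by rw [hαβ]; exact one_ne_zero), hαβ, Real.rpow_one]
    _ ≤ x ^ α * y ^ β := by gcongr <;> simp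

section Induction

variable {E : Type*} [NormedAddCommGroup E] [NormedSpace ℝ E] [MeasurableSpace E] [BorelSpace E]
  [SecondCountableTopology E] {μ : Measure E} [SFinite μ] [IsFiniteMeasureOnCompacts μ]
  [μ.OuterRegular]

theorem MulBrunnMinkowski.volume_prod (hμ : MulBrunnMinkowski μ) :
    MulBrunnMinkowski ((volume : Measure ℝ).prod μ) := by
  intro K L hK hL hKne hLne α β hα hβ hαβ
  have hC : IsCompact (α • K + β • L) := (hK.smul α).add (hL.smul β)
  obtain ⟨p₀, hp₀⟩ := exists_slice_max (μ := μ) hK hKne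
  obtain ⟨q₀, hq₀⟩ := exists_slice_max (μ := μ) hL hLne
  set f := fun p => μ.real (slice K p) with hf
  set g := fun p => μ.real (slice L p) with hg
  set h := fun p => μ.real (slice (α • K + β • L) p) with hh
  set M := f p₀ with hM
  set N := g q₀ with hN
  have hf0 : ∀ p, 0 ≤ f p := fun p => measureReal_nonneg
  have hg0 : ∀ p, 0 ≤ g p := fun p => measureReal_nonneg
  have hh0 : ∀ p, 0 ≤ h p := fun p => measureReal_nonneg
  have hKf : ∫⁻ p, ENNReal.ofReal (f p) = (volume.prod μ) K := lintegral_slice hK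
  have hLg : ∫⁻ p, ENNReal.ofReal (g p) = (volume.prod μ) L := lintegral_slice hL
  have hCh : ∫⁻ p, ENNReal.ofReal (h p) = (volume.prod μ) (α • K + β • L) := lintegral_slice hC
  rcases (hf0 p₀).eq_or_lt with hM0 | hM0
  · have : (volume.prod μ) K = 0 := by
      rw [← hKf, lintegral_eq_zero_iff (measurable_slice hK).ennreal_ofReal]
      exact ae_of_all _ fun p => by simpa using (hp₀ p).trans hM0.ge
    simp [Measure.real, this, hα.ne']
  rcases (hg0 q₀).eq_or_lt with hN0 | hN0
  · have : (volume.prod μ) L = 0 := by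
      rw [← hLg, lintegral_eq_zero_iff (measurable_slice hL).ennreal_ofReal]
      exact ae_of_all _ fun p => by simpa using (hq₀ p).trans hN0.ge
    simp [Measure.real, this, hβ.ne']
  have hM0' : 0 < M := hM0
  have hN0' : 0 < N := hN0
  have hD : 0 < M ^ α * N ^ β := by positivity
  have scale : ∀ (φ : ℝ → ℝ) (c : ℝ), 0 < c → Measurable φ →
      ∫⁻ p, ENNReal.ofReal (φ p / c) = ENNReal.ofReal c⁻¹ * ∫⁻ p, ENNReal.ofReal (φ p) := by
    intro φ c hc hφ
    rw [← lintegral_const_mul _ hφ.ennreal_ofReal]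
    refine lintegral_congr fun p => ?_
    rw [← ENNReal.ofReal_mul (inv_nonneg.2 hc.le), div_eq_inv_mul]
  have key := lintegral_le_of_superlevel (f := fun p => f p / M) (g := fun p => g p / N)
    (h := fun p => h p / (M ^ α * N ^ β)) hα hβ (fun p => div_nonneg (hf0 p) hM0.le)
    (fun p => div_nonneg (hg0 p) hN0.le) (fun p => div_nonneg (hh0 p) hD.le)
    ((measurable_slice hK).div_const _) ((measurable_slice hL).div_const _)
    ((measurable_slice hC).div_const _)
    (fun t ht => by
      have : {p | t ≤ f p / M} = {p | t * M ≤ f p} := by ext p; exact le_div_iff₀ hM0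
      rw [this]
      exact isCompact_superlevel_slice hK (mul_pos ht hM0))
    (fun t ht => by
      have : {p | t ≤ g p / N} = {p | t * N ≤ g p} := by ext p; exact le_div_iff₀ hN0
      rw [this]
      exact isCompact_superlevel_slice hL (mul_pos ht hN0))
    ⟨⟨p₀, div_self hM0.ne'⟩, by rintro _ ⟨p, rfl⟩; exact (div_le_one hM0).2 (hp₀ p)⟩
    ⟨⟨q₀, div_self hN0.ne'⟩, by rintro _ ⟨p, rfl⟩; exact (div_le_one hN0).2 (hq₀ p)⟩
    (fun p q => by
      rcases (hf0 p).eq_or_lt with h0 | h0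
      · exact (min_le_left _ _).trans (by rw [← h0, zero_div]; exact div_nonneg (hh0 _) hD.le)
      rcases (hg0 q).eq_or_lt with h1 | h1
      · exact (min_le_right _ _).trans (by rw [← h1, zero_div]; exact div_nonneg (hh0 _) hD.le)
      refine (min_le_rpow_mul_rpow (by positivity) (by positivity) hα hβ hαβ).trans ?_
      rw [Real.div_rpow h0.le hM0.le, Real.div_rpow h1.le hN0.le, div_mul_div_comm]
      gcongr
      refine (hμ (isCompact_slice hK p) (isCompact_slice hL q) (slice_nonempty_of_pos h0)
        (slice_nonempty_of_pos h1) hα hβ hαβ).trans ?_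
      exact measureReal_mono (slice_add_subset p q) (isCompact_slice hC _).measure_ne_top)
  rw [scale f M hM0 (measurable_slice hK), scale g N hN0 (measurable_slice hL),
    scale h _ hD (measurable_slice hC), hKf, hLg, hCh] at key
  have key' := ENNReal.toReal_mono
    (ENNReal.mul_ne_top ENNReal.ofReal_ne_top hC.measure_ne_top) key
  rw [ENNReal.toReal_add (ENNReal.mul_ne_top ENNReal.ofReal_ne_top
      (ENNReal.mul_ne_top ENNReal.ofReal_ne_top hK.measure_ne_top))
      (ENNReal.mul_ne_top ENNReal.ofReal_ne_top
      (ENNReal.mul_ne_top ENNReal.ofReal_ne_top hL.measure_ne_top))] at key'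
  simp only [ENNReal.toReal_mul, ENNReal.toReal_ofReal hα.le, ENNReal.toReal_ofReal hβ.le,
    ENNReal.toReal_ofReal (inv_nonneg.2 hM0'.le), ENNReal.toReal_ofReal (inv_nonneg.2 hN0'.le),
    ENNReal.toReal_ofReal (inv_nonneg.2 hD.le)] at key'
  have amgm := Real.geom_mean_le_arith_mean2_weighted hα.le hβ.le
    (p₁ := M⁻¹ * ((volume.prod μ) K).toReal) (p₂ := N⁻¹ * ((volume.prod μ) L).toReal)
    (by positivity) (by positivity) hαβ
  have := amgm.trans key'
  rw [Real.mul_rpow (by positivity) (by positivity), Real.mul_rpow (by positivity) (by positivity),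
    Real.inv_rpow hM0.le, Real.inv_rpow hN0.le, mul_mul_mul_comm, ← mul_inv] at this
  exact le_of_mul_le_mul_left this (inv_pos.2 hD)

end Induction

theorem MulBrunnMinkowski.of_equiv {E F : Type*} [NormedAddCommGroup E] [NormedSpace ℝ E]
    [MeasurableSpace E] [BorelSpace E] [NormedAddCommGroup F] [NormedSpace ℝ F]
    [MeasurableSpace F] [BorelSpace F] {μ : Measure E} {ν : Measure F}
    (hν : MulBrunnMinkowski ν) (e : E ≃L[ℝ] F) (he : μ.map e = ν) :
    MulBrunnMinkowski μ := by
  have hreal : ∀ K : Set E, μ.real K = ν.real (e '' K) := by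
    intro K
    have h := e.toHomeomorph.toMeasurableEquiv.map_apply (μ := μ) (e '' K)
    have h' : ν (e '' K) = μ (e ⁻¹' (e '' K)) := by rw [← he]; exact h
    rw [Measure.real, Measure.real, h', e.injective.preimage_image K]
  intro K L hK hL hKne hLne α β hα hβ hαβ
  rw [hreal, hreal, hreal, image_add, image_smul_set, image_smul_set]
  exact hν (hK.image e.continuous) (hL.image e.continuous) (hKne.image _) (hLne.image _) hα hβ hαβ

theorem mulBrunnMinkowski_fin (n : ℕ) : MulBrunnMinkowski (volume : Measure (Fin n → ℝ)) := by
  induction n with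
  | zero =>
    intro K L _ _ hK hL α β _ _ _
    have key : ∀ S : Set (Fin 0 → ℝ), S.Nonempty → (volume : Measure (Fin 0 → ℝ)).real S = 1 := by
      intro S hS
      rw [Subsingleton.eq_univ_of_nonempty hS]
      rw [Measure.real, volume_pi, Measure.pi_of_empty _ 0]
      simp
    rw [key K hK, key L hL, key _ (hK.smul_set.add hL.smul_set)]
    simp
  | succ n ih =>
    have h := ih.volume_prod
    refine h.of_equiv (Fin.consEquivL ℝ fun _ : Fin (n + 1) => ℝ).symm ?_
    have hmp := (volume_preserving_piFinSuccAbove (fun _ : Fin (n + 1) => ℝ) 0).map_eq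
    exact hmp

section Haar

variable {E : Type*} [NormedAddCommGroup E] [NormedSpace ℝ E] [FiniteDimensional ℝ E]
  [MeasurableSpace E] [BorelSpace E] (μ : Measure E) [μ.IsAddHaarMeasure]

theorem mulBrunnMinkowski : MulBrunnMinkowski μ := by
  let e : E ≃L[ℝ] (Fin (finrank ℝ E) → ℝ) := ContinuousLinearEquiv.ofFinrankEq (by simp)
  refine MulBrunnMinkowski.of_equiv (ν := μ.map e) ?_ e rfl
  have : (μ.map e).IsAddHaarMeasure := e.isAddHaarMeasure_map μ
  rw [Measure.isAddLeftInvariant_eq_smul (μ.map e) volume]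
  set c := Measure.addHaarScalarFactor (μ.map e) volume
  intro K L hK hL hKne hLne α β hα hβ hαβ
  have h := mulBrunnMinkowski_fin _ hK hL hKne hLne hα hβ hαβ
  simp only [measureReal_nnreal_smul_apply]
  rw [Real.mul_rpow (by positivity) (by positivity), Real.mul_rpow (by positivity) (by positivity),
    mul_mul_mul_comm, ← Real.rpow_add' (by positivity) (by rw [hαβ]; exact one_ne_zero), hαβ,
    Real.rpow_one]
  gcongr

theorem measureReal_vadd (x : E) (S : Set E) : μ.real (x +ᵥ S) = μ.real S := by
  rw [Measure.real, measure_vadd, Measure.real]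

/-- The Brunn-Minkowski inequality. -/
theorem brunnMinkowski (hE : 0 < finrank ℝ E) {K L : Set E} (hK : IsCompact K) (hL : IsCompact L)
    (hKne : K.Nonempty) (hLne : L.Nonempty) {α β : ℝ} (hα : 0 < α) (hβ : 0 < β) :
    α * μ.real K ^ (finrank ℝ E : ℝ)⁻¹ + β * μ.real L ^ (finrank ℝ E : ℝ)⁻¹ ≤
      μ.real (α • K + β • L) ^ (finrank ℝ E : ℝ)⁻¹ := by
  set n := finrank ℝ E with hn
  have hn0 : (n : ℝ) ≠ 0 := by positivity
  have smul_root : ∀ (c : ℝ) (S : Set E), 0 ≤ c →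
      μ.real (c • S) ^ (n : ℝ)⁻¹ = c * μ.real S ^ (n : ℝ)⁻¹ := by
    intro c S hc
    rw [Measure.real, Measure.addHaar_smul, ENNReal.toReal_mul,
      ENNReal.toReal_ofReal (abs_nonneg _), abs_of_nonneg (by positivity),
      Real.mul_rpow (by positivity) (by positivity),
      Real.pow_rpow_inv_natCast hc (by positivity)]
    rfl
  have hfin : μ (α • K + β • L) ≠ ⊤ := ((hK.smul α).add (hL.smul β)).measure_ne_top
  set k := μ.real K ^ (n : ℝ)⁻¹ with hk
  set l := μ.real L ^ (n : ℝ)⁻¹ with hl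
  have hk0 : 0 ≤ k := by positivity
  have hl0 : 0 ≤ l := by positivity
  rcases hk0.eq_or_lt with hk0 | hk0
  · obtain ⟨x, hx⟩ := hKne
    rw [← hk0, mul_zero, zero_add, ← smul_root β L hβ.le,
      ← measureReal_vadd μ (α • x) (β • L)]
    refine Real.rpow_le_rpow measureReal_nonneg (measureReal_mono ?_ hfin) (by positivity)
    rintro _ ⟨y, hy, rfl⟩
    exact ⟨_, ⟨x, hx, rfl⟩, y, hy, rfl⟩
  rcases hl0.eq_or_lt with hl0 | hl0
  · obtain ⟨x, hx⟩ := hLne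
    rw [← hl0, mul_zero, add_zero, ← smul_root α K hα.le,
      ← measureReal_vadd μ (β • x) (α • K)]
    refine Real.rpow_le_rpow measureReal_nonneg (measureReal_mono ?_ hfin) (by positivity)
    rintro _ ⟨y, hy, rfl⟩
    exact ⟨y, hy, _, ⟨x, hx, rfl⟩, add_comm _ _⟩
  set D := α * k + β * l with hD
  have hD0 : 0 < D := by positivity
  have hroot : ∀ S : Set E, 0 < μ.real S ^ (n : ℝ)⁻¹ →
      μ.real ((μ.real S ^ (n : ℝ)⁻¹)⁻¹ • S) = 1 := by
    intro S hS
    have h := smul_root (μ.real S ^ (n : ℝ)⁻¹)⁻¹ S (by positivity)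
    rw [inv_mul_cancel₀ hS.ne'] at h
    rw [← Real.rpow_inv_natCast_pow (x := μ.real (_ • S)) measureReal_nonneg
      (by positivity : n ≠ 0), h, one_pow]
  have h := mulBrunnMinkowski μ (hK.smul k⁻¹) (hL.smul l⁻¹) hKne.smul_set hLne.smul_set
    (div_pos (mul_pos hα hk0) hD0) (div_pos (mul_pos hβ hl0) hD0)
    (by rw [← add_div, div_self hD0.ne'])
  rw [hroot K hk0, hroot L hl0, Real.one_rpow, Real.one_rpow, one_mul, smul_smul, smul_smul] at h
  have e1 : α * k / D * k⁻¹ = D⁻¹ * α := by field_simp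
  have e2 : β * l / D * l⁻¹ = D⁻¹ * β := by field_simp
  rw [e1, e2, mul_smul, mul_smul, ← smul_add] at h
  have h2 := smul_root D⁻¹ (α • K + β • L) (by positivity)
  have h3 : 1 ≤ D⁻¹ * μ.real (α • K + β • L) ^ (n : ℝ)⁻¹ := by
    rw [← h2]
    exact Real.one_le_rpow h (by positivity)
  rwa [inv_mul_eq_div, one_le_div hD0] at h3

end Haar

/-! ### Matching of one-parameter families -/

theorem sub_eq_sub_of_forall_add_le {U : Set ℝ} (hU : IsOpen U) (hUc : U.OrdConnected)
    {φ ψ : ℝ → ℝ} (hφ : ContinuousOn φ U) (hψ : ContinuousOn ψ U) {α β : ℝ} (hα : 0 < α)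
    (hβ : 0 < β) (hαβ : α + β = 1)
    (h : ∀ p ∈ U, ∀ q ∈ U, α * φ p + β * ψ q ≤ α * φ (α * p + β * q) + β * ψ (α * p + β * q))
    {x y : ℝ} (hx : x ∈ U) (hy : y ∈ U) : φ x - ψ x = φ y - ψ y := by
  wlog hxy : x ≤ y generalizing x y
  · exact (this hy hx (le_of_not_ge hxy)).symm
  obtain ⟨ε, hε, hxε, hyε⟩ : ∃ ε > 0, x - ε ∈ U ∧ y + ε ∈ U := by
    have h1 : ∀ᶠ ε in 𝓝 (0 : ℝ), x - ε ∈ U :=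
      (show ContinuousAt (fun ε : ℝ => x - ε) 0 by fun_prop).eventually_mem
        (by simpa using hU.mem_nhds hx)
    have h2 : ∀ᶠ ε in 𝓝 (0 : ℝ), y + ε ∈ U :=
      (show ContinuousAt (fun ε : ℝ => y + ε) 0 by fun_prop).eventually_mem
        (by simpa using hU.mem_nhds hy)
    obtain ⟨ε, ⟨h1, h2⟩, hε⟩ := (((h1.and h2).filter_mono nhdsWithin_le_nhds).and
      (self_mem_nhdsWithin : Ioi (0 : ℝ) ∈ 𝓝[>] 0)).exists
    exact ⟨ε, hε, h1, h2⟩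
  have hle : x - ε ≤ y + ε := by linarith
  have hIU : Icc (x - ε) (y + ε) ⊆ U := hUc.out hxε hyε
  set f := IccExtend hle ((Icc (x - ε) (y + ε)).domRestrict φ) with hf
  set g := IccExtend hle ((Icc (x - ε) (y + ε)).domRestrict ψ) with hg
  have hfc : Continuous f := (hφ.mono hIU).domRestrict.Icc_extend'
  have hgc : Continuous g := (hψ.mono hIU).domRestrict.Icc_extend'
  have hfφ : ∀ p ∈ Icc (x - ε) (y + ε), f p = φ p := fun p hp => IccExtend_of_mem hle _ hp
  have hgψ : ∀ p ∈ Icc (x - ε) (y + ε), g p = ψ p := fun p hp => IccExtend_of_mem hle _ hp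
  set W : ℝ → ℝ := fun δ => ∫ m in x..y, (α * f (m + β * δ) + β * g (m + -(α * δ))) with hW
  have hmax : IsLocalMax W 0 := by
    have : Ioo (-ε) ε ∈ 𝓝 (0 : ℝ) := Ioo_mem_nhds (by linarith) hε
    filter_upwards [this] with δ hδ
    refine intervalIntegral.integral_mono_on hxy (Continuous.intervalIntegrable (by fun_prop) _ _)
      (Continuous.intervalIntegrable (by fun_prop) _ _) fun m hm => ?_
    have hm1 : m ∈ Icc (x - ε) (y + ε) := ⟨by linarith [hm.1], by linarith [hm.2]⟩
    have hβδ : |β * δ| ≤ ε := by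
      rw [abs_mul, abs_of_pos hβ]
      have : |δ| ≤ ε := (abs_lt.2 hδ).le
      nlinarith [abs_nonneg δ]
    have hαδ : |α * δ| ≤ ε := by
      rw [abs_mul, abs_of_pos hα]
      have : |δ| ≤ ε := (abs_lt.2 hδ).le
      nlinarith [abs_nonneg δ]
    rw [abs_le] at hβδ hαδ
    have hp : m + β * δ ∈ Icc (x - ε) (y + ε) :=
      ⟨by linarith [hm.1, hβδ.1], by linarith [hm.2, hβδ.2]⟩
    have hq : m + -(α * δ) ∈ Icc (x - ε) (y + ε) :=
      ⟨by linarith [hm.1, hαδ.2], by linarith [hm.2, hαδ.1]⟩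
    have key := h _ (hIU hp) _ (hIU hq)
    have hcomb : α * (m + β * δ) + β * (m + -(α * δ)) = m := by linear_combination m * hαβ
    rw [hcomb] at key
    simp only [mul_zero, neg_zero, add_zero]
    rwa [hfφ _ hp, hgψ _ hq, hfφ _ hm1, hgψ _ hm1]
  have hW' : W = fun δ =>
      α * ((∫ t in (0 : ℝ)..(y + β * δ), f t) - ∫ t in (0 : ℝ)..(x + β * δ), f t) +
      β * ((∫ t in (0 : ℝ)..(y + -(α * δ)), g t) - ∫ t in (0 : ℝ)..(x + -(α * δ)), g t) := by
    funext δ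
    rw [hW]
    simp only
    rw [intervalIntegral.integral_add (Continuous.intervalIntegrable (by fun_prop) _ _)
      (Continuous.intervalIntegrable (by fun_prop) _ _), intervalIntegral.integral_const_mul,
      intervalIntegral.integral_const_mul, intervalIntegral.integral_comp_add_right,
      intervalIntegral.integral_comp_add_right,
      intervalIntegral.integral_interval_sub_left (hfc.intervalIntegrable _ _)
        (hfc.intervalIntegrable _ _),
      intervalIntegral.integral_interval_sub_left (hgc.intervalIntegrable _ _)
        (hgc.intervalIntegrable _ _)]
  have hprim : ∀ (k : ℝ → ℝ), Continuous k → ∀ z s : ℝ,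
      HasDerivAt (fun δ => ∫ t in (0 : ℝ)..(z + s * δ), k t) (k z * s) 0 := by
    intro k hk z s
    have h1 : HasDerivAt (fun u => ∫ t in (0 : ℝ)..u, k t) (k (z + s * 0)) (z + s * 0) :=
      (hk.integral_hasStrictDerivAt 0 (z + s * 0)).hasDerivAt
    have h2 : HasDerivAt (fun δ : ℝ => z + s * δ) s 0 := by
      simpa using ((hasDerivAt_id (0 : ℝ)).const_mul s).const_add z
    have h3 := h1.comp (0 : ℝ) h2
    simp only [mul_zero, add_zero] at h3
    exact h3
  have hderiv : HasDerivAt W (α * (f y * β - f x * β) + β * (g y * (-α) - g x * (-α))) 0 := by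
    rw [hW']
    simp only [← neg_mul]
    exact (((hprim f hfc y β).sub (hprim f hfc x β)).const_mul α).add
      (((hprim g hgc y (-α)).sub (hprim g hgc x (-α))).const_mul β)
  have h0 := hmax.hasDerivAt_eq_zero hderiv
  have hx1 : x ∈ Icc (x - ε) (y + ε) := ⟨by linarith, by linarith⟩
  have hy1 : y ∈ Icc (x - ε) (y + ε) := ⟨by linarith, by linarith⟩
  rw [hfφ _ hx1, hfφ _ hy1, hgψ _ hx1, hgψ _ hy1] at h0
  have h1 : α * β * ((φ x - ψ x) - (φ y - ψ y)) = 0 := by linear_combination -h0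
  rcases mul_eq_zero.1 h1 with h1 | h1
  · exact absurd h1 (by positivity)
  · linarith

theorem continuousOn_quantile {F a : ℝ → ℝ} {T : ℝ}
    (ha : ∀ τ ∈ Ioo 0 T, IsLeast {p | τ ≤ F p} (a τ))
    (hF : ∀ p q, 0 < F p → 0 < F q → ∀ s t : ℝ, 0 ≤ s → 0 ≤ t → s + t = 1 →
      s * F p + t * F q ≤ F (s * p + t * q)) : ContinuousOn a (Ioo 0 T) := by
  refine ConvexOn.continuousOn isOpen_Ioo ⟨convex_Ioo 0 T, ?_⟩
  intro τ hτ τ' hτ' s t hs ht hst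
  refine (ha _ (convex_Ioo 0 T hτ hτ' hs ht hst)).2 ?_
  have h1 : τ ≤ F (a τ) := (ha τ hτ).1
  have h2 : τ' ≤ F (a τ') := (ha τ' hτ').1
  refine le_trans ?_ (hF _ _ (hτ.1.trans_le h1) (hτ'.1.trans_le h2) s t hs ht hst)
  simp only [smul_eq_mul]
  gcongr

theorem quantile_sub_eq {F G H a c : ℝ → ℝ} {T α β : ℝ} (hα : 0 < α) (hβ : 0 < β)
    (hαβ : α + β = 1)
    (ha : ∀ τ ∈ Ioo 0 T, IsLeast {p | τ ≤ F p} (a τ))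
    (hc : ∀ τ ∈ Ioo 0 T, IsLeast {p | τ ≤ G p} (c τ))
    (hF : ∀ p q, 0 < F p → 0 < F q → ∀ s t : ℝ, 0 ≤ s → 0 ≤ t → s + t = 1 →
      s * F p + t * F q ≤ F (s * p + t * q))
    (hG : ∀ p q, 0 < G p → 0 < G q → ∀ s t : ℝ, 0 ≤ s → 0 ≤ t → s + t = 1 →
      s * G p + t * G q ≤ G (s * p + t * q))
    (hH : ∀ p q, 0 < F p → 0 < G q → α * F p + β * G q ≤ H (α * p + β * q))
    (hE : ∀ τ' ∈ Ioo 0 T, ∀ τ, τ' < τ → ∀ r, τ ≤ H r → α * a τ' + β * c τ' ≤ r)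
    {τ τ' : ℝ} (hτ : τ ∈ Ioo 0 T) (hτ' : τ' ∈ Ioo 0 T) : a τ - c τ = a τ' - c τ' := by
  have hac := continuousOn_quantile ha hF
  have hcc := continuousOn_quantile hc hG
  have key := sub_eq_sub_of_forall_add_le isOpen_Ioo ordConnected_Ioo hac.neg hcc.neg hα hβ hαβ
    ?_ hτ hτ'
  · simp only [Pi.neg_apply] at key
    linarith
  intro s hs s' hs'
  set m := α * s + β * s' with hm
  have hmI : m ∈ Ioo 0 T := convex_Ioo 0 T hs hs' hα.le hβ.le hαβ
  have h1 : s ≤ F (a s) := (ha s hs).1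
  have h2 : s' ≤ G (c s') := (hc s' hs').1
  have hmH : m ≤ H (α * a s + β * c s') := by
    refine le_trans ?_ (hH _ _ (hs.1.trans_le h1) (hs'.1.trans_le h2))
    rw [hm]; gcongr
  have hcont : ContinuousWithinAt (fun τ => α * a τ + β * c τ) (Iio m) m :=
    (((hac.const_mul α).add (hcc.const_mul β)).continuousAt
      (isOpen_Ioo.mem_nhds hmI)).continuousWithinAt
  have hle : α * a m + β * c m ≤ α * a s + β * c s' := by
    refine le_of_tendsto hcont ?_
    filter_upwards [Ioo_mem_nhdsLT hmI.1] with σ hσ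
    exact hE σ ⟨hσ.1, hσ.2.trans hmI.2⟩ m hσ.2 _ hmH
  simp only [Pi.neg_apply]
  linarith

/-! ### The equality case of the Brunn-Minkowski inequality for bodies of equal volume -/

theorem inter_preimage_Iic_add_subset {E : Type*} [NormedAddCommGroup E] [NormedSpace ℝ E]
    {K L : Set E} (ℓ : E →L[ℝ] ℝ) {s t : ℝ} (hs : 0 ≤ s)
    (ht : 0 ≤ t) (p q : ℝ) : s • (K ∩ ℓ ⁻¹' Iic p) + t • (L ∩ ℓ ⁻¹' Iic q) ⊆
      (s • K + t • L) ∩ ℓ ⁻¹' Iic (s * p + t * q) := by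
  rintro _ ⟨_, ⟨x, ⟨hx, hxp⟩, rfl⟩, _, ⟨y, ⟨hy, hyq⟩, rfl⟩, rfl⟩
  refine ⟨add_mem_add (smul_mem_smul_set hx) (smul_mem_smul_set hy), ?_⟩
  simp only [mem_preimage, mem_Iic, map_add, map_smul, smul_eq_mul] at *
  gcongr

theorem inter_preimage_Ici_add_subset {E : Type*} [NormedAddCommGroup E] [NormedSpace ℝ E]
    {K L : Set E} (ℓ : E →L[ℝ] ℝ) {s t : ℝ} (hs : 0 ≤ s)
    (ht : 0 ≤ t) (p q : ℝ) : s • (K ∩ ℓ ⁻¹' Ici p) + t • (L ∩ ℓ ⁻¹' Ici q) ⊆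
      (s • K + t • L) ∩ ℓ ⁻¹' Ici (s * p + t * q) := by
  rintro _ ⟨_, ⟨x, ⟨hx, hxp⟩, rfl⟩, _, ⟨y, ⟨hy, hyq⟩, rfl⟩, rfl⟩
  refine ⟨add_mem_add (smul_mem_smul_set hx) (smul_mem_smul_set hy), ?_⟩
  simp only [mem_preimage, mem_Ici, map_add, map_smul, smul_eq_mul] at *
  gcongr

theorem setIntegral_eq_add_of_measureReal_lowerPart_eq {E : Type*} [NormedAddCommGroup E]
    [NormedSpace ℝ E] [MeasurableSpace E] [BorelSpace E] {μ : Measure E}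
    [IsFiniteMeasureOnCompacts μ] {K L : Set E} (hK : IsCompact K)
    (hL : IsCompact L) (ℓ : E →L[ℝ] ℝ) {k : ℝ}
    (h : ∀ p, μ.real (K ∩ ℓ ⁻¹' Iic p) = μ.real (L ∩ ℓ ⁻¹' Iic (p + k))) :
    ∫ y in L, ℓ y ∂μ = (∫ y in K, ℓ y ∂μ) + k * μ.real K := by
  have hKm := hK.measurableSet
  have hLm := hL.measurableSet
  have hcl : ∀ p, IsClosed (ℓ ⁻¹' Iic p) := fun p => isClosed_Iic.preimage ℓ.continuous
  have : IsFiniteMeasure (μ.restrict K) := isFiniteMeasure_restrict.2 hK.measure_ne_top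
  have : IsFiniteMeasure (μ.restrict L) := isFiniteMeasure_restrict.2 hL.measure_ne_top
  have hmeas : Measurable fun y => ℓ y + k := (ℓ.continuous.add continuous_const).measurable
  have hmap : (μ.restrict K).map (fun y => ℓ y + k) = (μ.restrict L).map ℓ := by
    have : IsFiniteMeasure ((μ.restrict K).map fun y => ℓ y + k) := inferInstance
    refine Measure.ext_of_Iic _ _ fun p => ?_
    rw [Measure.map_apply hmeas measurableSet_Iic,
      Measure.map_apply ℓ.continuous.measurable measurableSet_Iic,
      Measure.restrict_apply (hmeas measurableSet_Iic), Measure.restrict_apply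
        (ℓ.continuous.measurable measurableSet_Iic), inter_comm, inter_comm _ L]
    have h1 := h (p - k)
    rw [sub_add_cancel, measureReal_def, measureReal_def, ENNReal.toReal_eq_toReal_iff'
      (hK.inter_right (hcl _)).measure_ne_top (hL.inter_right (hcl _)).measure_ne_top] at h1
    rw [← h1]
    congr 2
    ext y
    simp [le_sub_iff_add_le]
  have h1 : ∫ y in L, ℓ y ∂μ = ∫ x, x ∂((μ.restrict L).map ℓ) :=
    (integral_map ℓ.continuous.measurable.aemeasurable aestronglyMeasurable_id).symm
  have h2 : ∫ y in K, (ℓ y + k) ∂μ = ∫ x, x ∂((μ.restrict K).map fun y => ℓ y + k) :=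
    (integral_map hmeas.aemeasurable aestronglyMeasurable_id).symm
  rw [h1, ← hmap, ← h2, integral_add (ℓ.continuous.continuousOn.integrableOn_compact hK)
    (integrable_const _)]
  simp [mul_comm]

section Haar

variable {E : Type*} [NormedAddCommGroup E] [NormedSpace ℝ E] [FiniteDimensional ℝ E]
  [MeasurableSpace E] [BorelSpace E] {μ : Measure E} [μ.IsAddHaarMeasure]

theorem interior_nonempty_of_measure_pos {K : Set E} (hK : Convex ℝ K)
    (h : 0 < μ.real K) : (interior K).Nonempty := by
  by_contra hne
  rw [not_nonempty_iff_eq_empty] at hne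
  have h1 : μ K ≤ μ (frontier K) :=
    measure_mono (by rw [frontier, hne, sdiff_empty]; exact subset_closure)
  rw [hK.addHaar_frontier μ, nonpos_iff_eq_zero] at h1
  simp [Measure.real, h1] at h

theorem eq_of_subset_of_measureReal_le {K L : Set E} (hK : IsClosed K) (hL : IsCompact L)
    (hLc : Convex ℝ L) (hL0 : 0 < μ.real L) (hKL : K ⊆ L) (h : μ.real L ≤ μ.real K) : K = L := by
  refine hKL.antisymm fun z hz => ?_
  by_contra hzK
  have hzc : z ∈ closure (interior L) := by
    rw [hLc.closure_interior_eq_closure_of_nonempty_interior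
      (interior_nonempty_of_measure_pos hLc hL0)]
    exact subset_closure hz
  obtain ⟨y, hyK, hyL⟩ := mem_closure_iff.1 hzc _ hK.isOpen_compl hzK
  have hpos : 0 < μ (L \ K) :=
    ((hK.isOpen_compl.inter isOpen_interior).measure_pos μ ⟨y, hyK, hyL⟩).trans_le
      (measure_mono fun w hw => ⟨interior_subset hw.2, hw.1⟩)
  have hfin : μ L ≠ ⊤ := hL.measure_ne_top
  rw [measure_sdiff hKL hK.measurableSet.nullMeasurableSet
    (ne_top_of_le_ne_top hfin (measure_mono hKL)), tsub_pos_iff_lt] at hpos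
  exact absurd h (not_le.2 ((ENNReal.toReal_lt_toReal
    (ne_top_of_le_ne_top hfin (measure_mono hKL)) hfin).2 hpos))

theorem brunnMinkowski_of_subset (hE : 0 < finrank ℝ E) {K L M : Set E} (hK : IsCompact K)
    (hL : IsCompact L) (hM : IsCompact M) (hKne : K.Nonempty) (hLne : L.Nonempty) {s t : ℝ}
    (hs : 0 ≤ s) (ht : 0 ≤ t) (h : s • K + t • L ⊆ M) :
    s * μ.real K ^ (finrank ℝ E : ℝ)⁻¹ + t * μ.real L ^ (finrank ℝ E : ℝ)⁻¹ ≤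
      μ.real M ^ (finrank ℝ E : ℝ)⁻¹ := by
  have hinv : 0 < (finrank ℝ E : ℝ)⁻¹ := by positivity
  have hle : μ.real (s • K + t • L) ^ (finrank ℝ E : ℝ)⁻¹ ≤ μ.real M ^ (finrank ℝ E : ℝ)⁻¹ :=
    Real.rpow_le_rpow measureReal_nonneg (measureReal_mono h hM.measure_ne_top) hinv.le
  refine le_trans ?_ hle
  have hroot : ∀ (c : ℝ) (S : Set E), 0 ≤ c →
      μ.real (c • S) ^ (finrank ℝ E : ℝ)⁻¹ = c * μ.real S ^ (finrank ℝ E : ℝ)⁻¹ := by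
    intro c S hc
    rw [Measure.real, Measure.addHaar_smul, ENNReal.toReal_mul,
      ENNReal.toReal_ofReal (abs_nonneg _), Real.mul_rpow (abs_nonneg _) ENNReal.toReal_nonneg,
      abs_of_nonneg (pow_nonneg hc _), ← Real.rpow_natCast, ← Real.rpow_mul hc,
      mul_inv_cancel₀ (by positivity), Real.rpow_one, Measure.real]
  rcases hs.eq_or_lt with rfl | hs
  · rw [zero_smul_set hKne, zero_add, hroot t L ht]; simp
  rcases ht.eq_or_lt with rfl | ht
  · rw [zero_smul_set hLne, add_zero, hroot s K hs.le]; simp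
  exact brunnMinkowski μ hE hK hL hKne hLne hs ht

theorem exists_isLeast_lowerPart {K : Set E} (hK : IsCompact K) (ℓ : E →L[ℝ] ℝ) {t : ℝ}
    (ht : 0 < t) (htK : t ≤ μ.real K) :
    ∃ a, IsLeast {p | t ≤ μ.real (K ∩ ℓ ⁻¹' Iic p)} a := by
  have hKne : K.Nonempty := by
    by_contra hne
    rw [not_nonempty_iff_eq_empty] at hne
    simp [hne] at htK
    linarith
  obtain ⟨m, hm⟩ := (hK.image ℓ.continuous).bddBelow
  obtain ⟨M, hM⟩ := (hK.image ℓ.continuous).bddAbove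
  set S : Set (ℝ × E) := (Icc m M ×ˢ K) ∩ {z | ℓ z.2 ≤ z.1} with hS
  have hSc : IsCompact S := (isCompact_Icc.prod hK).inter_right
    (isClosed_le (by fun_prop) continuous_fst)
  have hsl : ∀ p ∈ Icc m M, slice S p = K ∩ ℓ ⁻¹' Iic p := by
    intro p hp
    ext y
    simp only [mem_slice, hS, mem_inter_iff, mem_prod, mem_ofPred_eq, mem_preimage, mem_Iic]
    tauto
  have hmM : m ≤ M := by
    obtain ⟨y, hy⟩ := hKne
    exact (hm (mem_image_of_mem _ hy)).trans (hM (mem_image_of_mem _ hy))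
  have hKM : K ∩ ℓ ⁻¹' Iic M = K :=
    inter_eq_left.2 fun y hy => hM (mem_image_of_mem _ hy)
  have hMmem : M ∈ {p | t ≤ μ.real (slice S p)} := by
    rw [mem_ofPred_eq, hsl M ⟨hmM, le_rfl⟩, hKM]; exact htK
  obtain ⟨a, ha, hamin⟩ := (isCompact_superlevel_slice (μ := μ) hSc ht).exists_isLeast ⟨M, hMmem⟩
  have haI : a ∈ Icc m M := by
    obtain ⟨y, hy⟩ := slice_nonempty_of_pos (ht.trans_le ha)
    exact hy.1.1
  refine ⟨a, ?_, fun p hp => ?_⟩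
  · rw [mem_ofPred_eq, hsl a haI] at ha
    exact ha
  · rcases le_total p M with hpM | hpM
    · refine hamin ?_
      have hpm : m ≤ p := by
        obtain ⟨y, hy, hyp⟩ := nonempty_of_measureReal_ne_zero (ht.trans_le hp).ne'
        exact (hm (mem_image_of_mem _ hy)).trans hyp
      rw [mem_ofPred_eq, hsl p ⟨hpm, hpM⟩]
      exact hp
    · exact haI.2.trans hpM

/-- In the equality case of the Brunn-Minkowski inequality, the parts of the two bodies cut off by
half-spaces have matching volumes. -/
theorem exists_measureReal_lowerPart_eq (hE : 0 < finrank ℝ E) {K L : Set E} (hK : IsCompact K)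
    (hL : IsCompact L) (hKc : Convex ℝ K) (hLc : Convex ℝ L) (hK0 : 0 < μ.real K)
    (hKL : μ.real L = μ.real K) {α β : ℝ} (hα : 0 < α) (hβ : 0 < β) (hαβ : α + β = 1)
    (h : μ.real (α • K + β • L) ≤ μ.real K) (ℓ : E →L[ℝ] ℝ) :
    ∃ k, ∀ p, μ.real (K ∩ ℓ ⁻¹' Iic p) = μ.real (L ∩ ℓ ⁻¹' Iic (p + k)) := by
  set n := finrank ℝ E with hn
  have hn0 : (n : ℝ) ≠ 0 := by positivity
  have hinv : 0 < (n : ℝ)⁻¹ := by positivity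
  set v := μ.real K with hv
  have hC : IsCompact (α • K + β • L) := (hK.smul α).add (hL.smul β)
  have hcl : ∀ p, IsClosed (ℓ ⁻¹' Iic p) := fun p => isClosed_Iic.preimage ℓ.continuous
  have hcl' : ∀ p, IsClosed (ℓ ⁻¹' Ici p) := fun p => isClosed_Ici.preimage ℓ.continuous
  set F : Set E → ℝ → ℝ := fun S p => μ.real (S ∩ ℓ ⁻¹' Iic p) ^ (n : ℝ)⁻¹ with hF
  have hFiff : ∀ (S : Set E) (τ p : ℝ), 0 ≤ τ →
      (τ ≤ F S p ↔ τ ^ (n : ℝ) ≤ μ.real (S ∩ ℓ ⁻¹' Iic p)) := fun S τ p hτ =>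
    Real.le_rpow_inv_iff_of_pos hτ measureReal_nonneg (by positivity)
  set T := v ^ (n : ℝ)⁻¹ with hT
  have hT0 : 0 < T := Real.rpow_pos_of_pos hK0 _
  have hτv : ∀ τ ∈ Ioo 0 T, τ ^ (n : ℝ) < v := fun τ hτ =>
    (Real.lt_rpow_inv_iff_of_pos hτ.1.le hK0.le (by positivity)).1 hτ.2
  have hleast : ∀ S : Set E, IsCompact S → μ.real S = v → ∀ τ : ℝ, ∃ a, τ ∈ Ioo 0 T →
      IsLeast {p | τ ≤ F S p} a := by
    intro S hS hSv τ
    by_cases hτ : τ ∈ Ioo 0 T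
    · obtain ⟨a, ha⟩ := exists_isLeast_lowerPart (μ := μ) hS ℓ
        (Real.rpow_pos_of_pos hτ.1 (n : ℝ)) (by rw [hSv]; exact (hτv τ hτ).le)
      refine ⟨a, fun _ => ?_⟩
      simpa only [hFiff S τ _ hτ.1.le] using ha
    · exact ⟨0, fun h => absurd h hτ⟩
  have hne : ∀ (S : Set E) (p : ℝ), 0 < F S p → (S ∩ ℓ ⁻¹' Iic p).Nonempty := by
    intro S p hp
    refine nonempty_of_measureReal_ne_zero (μ := μ) fun h0 => ?_
    simp only [hF, h0, Real.zero_rpow hinv.ne'] at hp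
    exact lt_irrefl _ hp
  have hconc : ∀ S : Set E, IsCompact S → Convex ℝ S → ∀ p q, 0 < F S p → 0 < F S q →
      ∀ s t : ℝ, 0 ≤ s → 0 ≤ t → s + t = 1 → s * F S p + t * F S q ≤ F S (s * p + t * q) := by
    intro S hS hSc p q hp hq s t hs ht hst
    exact brunnMinkowski_of_subset hE (hS.inter_right (hcl _)) (hS.inter_right (hcl _))
      (hS.inter_right (hcl _)) (hne S p hp) (hne S q hq) hs ht
      ((inter_preimage_Iic_add_subset ℓ hs ht p q).trans
        (inter_subset_inter_left _ (hSc.set_combo_subset hs ht hst)))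
  choose a ha using hleast K hK rfl
  choose c hc using hleast L hL hKL
  have hupper : ∀ (S : Set E), IsCompact S → μ.real S = v → ∀ τ ∈ Ioo 0 T, ∀ a p,
      IsLeast {p | τ ≤ F S p} a → p < a → v - τ ^ (n : ℝ) < μ.real (S ∩ ℓ ⁻¹' Ici p) := by
    intro S hS hSv τ hτ a p ha hp
    have h1 : μ.real (S ∩ ℓ ⁻¹' Iic p) < τ ^ (n : ℝ) := by
      by_contra! h1
      exact absurd (ha.2 ((hFiff S τ p hτ.1.le).2 h1)) (not_le.2 hp)
    have h2 : S ⊆ (S ∩ ℓ ⁻¹' Iic p) ∪ (S ∩ ℓ ⁻¹' Ici p) := by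
      intro y hy
      rcases le_total (ℓ y) p with h | h
      · exact Or.inl ⟨hy, h⟩
      · exact Or.inr ⟨hy, h⟩
    have h3 := (measureReal_mono (μ := μ) h2 ((hS.inter_right (hcl p)).union
      (hS.inter_right (hcl' p))).measure_ne_top).trans (measureReal_union_le _ _)
    linarith
  have hEq : ∀ τ' ∈ Ioo 0 T, ∀ τ, τ' < τ → ∀ r, τ ≤ F (α • K + β • L) r →
      α * a τ' + β * c τ' ≤ r := by
    intro τ' hτ' τ hττ' r hr
    by_contra! hlt
    obtain ⟨ε, hε, hεr⟩ : ∃ ε > 0, r < α * (a τ' - ε) + β * (c τ' - ε) := by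
      refine ⟨(α * a τ' + β * c τ' - r) / 2, by linarith, ?_⟩
      have : α * (a τ' - (α * a τ' + β * c τ' - r) / 2) +
        β * (c τ' - (α * a τ' + β * c τ' - r) / 2) = α * a τ' + β * c τ' -
          (α + β) * ((α * a τ' + β * c τ' - r) / 2) := by ring
      rw [this, hαβ]
      linarith
    have h1 := hupper K hK rfl τ' hτ' _ (a τ' - ε) (ha τ' hτ') (by linarith)
    have h2 := hupper L hL hKL τ' hτ' _ (c τ' - ε) (hc τ' hτ') (by linarith)
    have hpos : 0 < v - τ' ^ (n : ℝ) := sub_pos.2 (hτv τ' hτ')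
    have h3 := mulBrunnMinkowski μ (hK.inter_right (hcl' _)) (hL.inter_right (hcl' _))
      (nonempty_of_measureReal_ne_zero (hpos.trans h1).ne')
      (nonempty_of_measureReal_ne_zero (hpos.trans h2).ne') hα hβ hαβ
    have h4 := ((min_le_rpow_mul_rpow measureReal_nonneg measureReal_nonneg hα hβ hαβ).trans
      h3).trans (measureReal_mono (inter_preimage_Ici_add_subset ℓ hα.le hβ.le _ _)
        (hC.inter_right (hcl' _)).measure_ne_top)
    have h5 := (lt_min h1 h2).trans_le h4
    have hdisj : Disjoint ((α • K + β • L) ∩ ℓ ⁻¹' Iic r)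
        ((α • K + β • L) ∩ ℓ ⁻¹' Ici (α * (a τ' - ε) + β * (c τ' - ε))) := by
      rw [Set.disjoint_left]
      rintro y ⟨-, hy⟩ ⟨-, hy'⟩
      exact absurd (hεr.trans_le hy') (not_lt.2 hy)
    have h6 := measureReal_union (μ := μ) hdisj (hC.inter_right (hcl' _)).measurableSet
      (hC.inter_right (hcl _)).measure_ne_top (hC.inter_right (hcl' _)).measure_ne_top
    have h7 : μ.real (((α • K + β • L) ∩ ℓ ⁻¹' Iic r) ∪ ((α • K + β • L) ∩
        ℓ ⁻¹' Ici (α * (a τ' - ε) + β * (c τ' - ε)))) ≤ v :=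
      (measureReal_mono (union_subset inter_subset_left inter_subset_left)
        hC.measure_ne_top).trans h
    have h8 := (hFiff _ τ r (hτ'.1.trans hττ').le).1 hr
    have h9 : τ' ^ (n : ℝ) < τ ^ (n : ℝ) := Real.rpow_lt_rpow hτ'.1.le hττ' (by positivity)
    linarith
  have hquant : ∀ τ ∈ Ioo 0 T, c τ = a τ + (c (T / 2) - a (T / 2)) := by
    intro τ hτ
    have := quantile_sub_eq hα hβ hαβ ha hc (hconc K hK hKc) (hconc L hL hLc)
      (H := F (α • K + β • L)) (fun p q hp hq => brunnMinkowski_of_subset hE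
        (hK.inter_right (hcl _)) (hL.inter_right (hcl _)) (hC.inter_right (hcl _))
        (hne K p hp) (hne L q hq) hα.le hβ.le (inter_preimage_Iic_add_subset ℓ hα.le hβ.le p q))
      hEq hτ (τ' := T / 2) ⟨by positivity, by linarith⟩
    linarith
  set k := c (T / 2) - a (T / 2) with hk
  have hmono : ∀ (S : Set E), IsCompact S → Monotone (F S) := fun S hS p q hpq =>
    Real.rpow_le_rpow measureReal_nonneg (measureReal_mono (inter_subset_inter_right _
      (preimage_mono (Iic_subset_Iic.2 hpq))) (hS.inter_right (hcl _)).measure_ne_top) hinv.le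
  have hleT : ∀ (S : Set E), IsCompact S → μ.real S = v → ∀ p, F S p ≤ T := fun S hS hSv p =>
    Real.rpow_le_rpow measureReal_nonneg ((measureReal_mono inter_subset_left
      hS.measure_ne_top).trans hSv.le) hinv.le
  have hF0 : ∀ (S : Set E) p, 0 ≤ F S p := fun S p => Real.rpow_nonneg measureReal_nonneg _
  refine ⟨k, fun p => ?_⟩
  have hFeq : F K p = F L (p + k) := by
    refine le_antisymm (le_of_forall_lt_imp_le_of_dense fun τ hτ => ?_)
      (le_of_forall_lt_imp_le_of_dense fun τ hτ => ?_)
    · rcases le_or_gt τ 0 with h0 | h0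
      · exact h0.trans (hF0 _ _)
      have hτI : τ ∈ Ioo 0 T := ⟨h0, hτ.trans_le (hleT K hK rfl p)⟩
      have h1 : a τ ≤ p := (ha τ hτI).2 hτ.le
      exact (hc τ hτI).1.trans (hmono L hL (by rw [hquant τ hτI]; linarith))
    · rcases le_or_gt τ 0 with h0 | h0
      · exact h0.trans (hF0 _ _)
      have hτI : τ ∈ Ioo 0 T := ⟨h0, hτ.trans_le (hleT L hL hKL _)⟩
      have h1 : c τ ≤ p + k := (hc τ hτI).2 hτ.le
      rw [hquant τ hτI] at h1
      exact (ha τ hτI).1.trans (hmono K hK (by linarith))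
  exact (Real.rpow_left_inj measureReal_nonneg measureReal_nonneg hinv.ne').1 hFeq

/-- The equality case of the Brunn-Minkowski inequality for convex bodies of equal volume. -/
theorem exists_eq_vadd_of_measureReal_add_le (hE : 0 < finrank ℝ E) {K L : Set E}
    (hK : IsCompact K) (hL : IsCompact L) (hKc : Convex ℝ K) (hLc : Convex ℝ L)
    (hK0 : 0 < μ.real K) (hKL : μ.real L = μ.real K) {α β : ℝ} (hα : 0 < α) (hβ : 0 < β)
    (hαβ : α + β = 1) (h : μ.real (α • K + β • L) ≤ μ.real K) : ∃ x : E, L = x +ᵥ K := by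
  set x : E := (μ.real K)⁻¹ • ((∫ y in L, y ∂μ) - ∫ y in K, y ∂μ) with hx
  have hlow : ∀ (ℓ : E →L[ℝ] ℝ) p,
      μ.real (K ∩ ℓ ⁻¹' Iic p) = μ.real (L ∩ ℓ ⁻¹' Iic (p + ℓ x)) := by
    intro ℓ
    obtain ⟨k, hk⟩ :=
      exists_measureReal_lowerPart_eq hE hK hL hKc hLc hK0 hKL hα hβ hαβ h ℓ
    have hint := setIntegral_eq_add_of_measureReal_lowerPart_eq hK hL ℓ hk
    rw [ℓ.integral_comp_comm (φ := fun y => y)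
        (continuous_id.continuousOn.integrableOn_compact hL),
      ℓ.integral_comp_comm (φ := fun y => y)
        (continuous_id.continuousOn.integrableOn_compact hK)] at hint
    have : ℓ x = k := by
      rw [hx, map_smul, map_sub, hint, smul_eq_mul]
      field_simp
      ring
    rwa [this]
  refine ⟨x, ?_⟩
  have hsub : L ⊆ x +ᵥ K := by
    intro z hz
    by_contra hzK
    have hzx : z - x ∉ K := fun hmem => hzK ⟨z - x, hmem, by simp⟩
    obtain ⟨ℓ, m, hm, hmz⟩ := geometric_hahn_banach_closed_point hKc hK.isClosed hzx
    have hKm : K ∩ ℓ ⁻¹' Iic m = K := inter_eq_left.2 fun y hy => (hm y hy).le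
    have h1 := hlow ℓ m
    rw [hKm] at h1
    have h2 := eq_of_subset_of_measureReal_le (μ := μ)
      (hL.inter_right (isClosed_Iic.preimage ℓ.continuous)).isClosed hL hLc
      (hKL ▸ hK0) inter_subset_left (hKL.trans h1).le
    have h3 := (h2.ge hz).2
    simp only [mem_preimage, mem_Iic] at h3
    rw [map_sub] at hmz
    linarith
  exact eq_of_subset_of_measureReal_le (μ := μ) hL.isClosed (hK.vadd x) (hKc.vadd x)
    (by rwa [measureReal_vadd]) hsub (by rw [measureReal_vadd, hKL])

end Haar

/-! ### The radius function of a body with respect to horizontal slices -/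

theorem smul_slice_add_subset {E : Type*} [AddCommGroup E] [Module ℝ E]
    {S : Set (ℝ × E)} (hS : Convex ℝ S) (p q : ℝ) {s t : ℝ}
    (hs : 0 ≤ s) (ht : 0 ≤ t) (hst : s + t = 1) :
    s • slice S p + t • slice S q ⊆ slice S (s * p + t * q) :=
  (slice_add_subset p q).trans fun _ hy => hS.set_combo_subset hs ht hst hy

section SliceRoot

variable {E : Type*} [NormedAddCommGroup E] [NormedSpace ℝ E] [MeasurableSpace E]

/-- The `n`-th root of the volume of the slice of `S ⊆ ℝ × E` at height `p`, `n = dim E`. -/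
noncomputable def sliceRoot (μ : Measure E) (S : Set (ℝ × E)) (p : ℝ) : ℝ :=
  μ.real (slice S p) ^ (finrank ℝ E : ℝ)⁻¹

variable {μ : Measure E} {S : Set (ℝ × E)}

theorem sliceRoot_nonneg (p : ℝ) : 0 ≤ sliceRoot μ S p := Real.rpow_nonneg measureReal_nonneg _

theorem le_sliceRoot_iff (hE : 0 < finrank ℝ E) {τ : ℝ} (hτ : 0 ≤ τ) (p : ℝ) :
    τ ≤ sliceRoot μ S p ↔ τ ^ (finrank ℝ E : ℝ) ≤ μ.real (slice S p) :=
  Real.le_rpow_inv_iff_of_pos hτ measureReal_nonneg (by positivity)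

theorem measureReal_slice_pos (hE : 0 < finrank ℝ E) {p : ℝ} (hp : 0 < sliceRoot μ S p) :
    0 < μ.real (slice S p) := by
  refine measureReal_nonneg.lt_of_ne fun h0 => ?_
  rw [sliceRoot, ← h0, Real.zero_rpow (by positivity)] at hp
  exact lt_irrefl _ hp

theorem slice_nonempty_of_sliceRoot_pos (hE : 0 < finrank ℝ E) {p : ℝ}
    (hp : 0 < sliceRoot μ S p) : (slice S p).Nonempty :=
  slice_nonempty_of_pos (measureReal_slice_pos hE hp)

variable [FiniteDimensional ℝ E] [BorelSpace E] [μ.IsAddHaarMeasure]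

theorem isCompact_superlevel_sliceRoot (hE : 0 < finrank ℝ E) (hS : IsCompact S) {τ : ℝ}
    (hτ : 0 < τ) : IsCompact {p | τ ≤ sliceRoot μ S p} := by
  simp only [le_sliceRoot_iff hE hτ.le]
  exact isCompact_superlevel_slice hS (Real.rpow_pos_of_pos hτ _)

theorem sliceRoot_add_le (hE : 0 < finrank ℝ E) {K L M : Set (ℝ × E)} (hK : IsCompact K)
    (hL : IsCompact L) (hM : IsCompact M) {p q r : ℝ} (hp : (slice K p).Nonempty)
    (hq : (slice L q).Nonempty) {s t : ℝ} (hs : 0 ≤ s) (ht : 0 ≤ t)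
    (h : s • slice K p + t • slice L q ⊆ slice M r) :
    s * sliceRoot μ K p + t * sliceRoot μ L q ≤ sliceRoot μ M r :=
  brunnMinkowski_of_subset hE (isCompact_slice hK p) (isCompact_slice hL q) (isCompact_slice hM r)
    hp hq hs ht h

theorem sliceRoot_concave (hE : 0 < finrank ℝ E) (hS : IsCompact S) (hSc : Convex ℝ S) {p q : ℝ}
    (hp : (slice S p).Nonempty) (hq : (slice S q).Nonempty) {s t : ℝ} (hs : 0 ≤ s) (ht : 0 ≤ t)
    (hst : s + t = 1) :
    s * sliceRoot μ S p + t * sliceRoot μ S q ≤ sliceRoot μ S (s * p + t * q) :=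
  sliceRoot_add_le hE hS hS hS hp hq hs ht (smul_slice_add_subset hSc p q hs ht hst)

theorem convex_superlevel_sliceRoot (hE : 0 < finrank ℝ E) (hS : IsCompact S) (hSc : Convex ℝ S)
    {τ : ℝ} (hτ : 0 < τ) : Convex ℝ {p | τ ≤ sliceRoot μ S p} := by
  intro p (hp : τ ≤ _) q (hq : τ ≤ _) s t hs ht hst
  have h := sliceRoot_concave (μ := μ) hE hS hSc
    (slice_nonempty_of_sliceRoot_pos hE (hτ.trans_le hp))
    (slice_nonempty_of_sliceRoot_pos hE (hτ.trans_le hq)) hs ht hst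
  calc τ = s * τ + t * τ := by rw [← add_mul, hst, one_mul]
    _ ≤ s * sliceRoot μ S p + t * sliceRoot μ S q := by gcongr
    _ ≤ _ := h

theorem le_sliceRoot_of_mem_Icc (hE : 0 < finrank ℝ E) (hS : IsCompact S) (hSc : Convex ℝ S)
    {τ p q r : ℝ} (hτ : 0 < τ) (hp : τ ≤ sliceRoot μ S p) (hq : τ ≤ sliceRoot μ S q)
    (hpr : p ≤ r) (hrq : r ≤ q) : τ ≤ sliceRoot μ S r :=
  (convex_superlevel_sliceRoot hE hS hSc hτ).ordConnected.out hp hq ⟨hpr, hrq⟩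

theorem superlevel_sliceRoot_eq_Icc (hE : 0 < finrank ℝ E) (hS : IsCompact S) (hSc : Convex ℝ S)
    {τ : ℝ} (hτ : 0 < τ) (hne : ∃ p, τ ≤ sliceRoot μ S p) :
    ∃ a b, a ≤ b ∧ {p | τ ≤ sliceRoot μ S p} = Icc a b := by
  have hconv := convex_superlevel_sliceRoot (μ := μ) hE hS hSc hτ
  have h := eq_Icc_of_connected_compact ⟨hne, hconv.isPreconnected⟩
    (isCompact_superlevel_sliceRoot (μ := μ) hE hS hτ)
  refine ⟨_, _, ?_, h⟩
  by_contra hlt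
  rw [Icc_eq_empty hlt] at h
  obtain ⟨p, hp⟩ := hne
  exact (h ▸ hp : p ∈ (∅ : Set ℝ))

theorem mul_sliceRoot_le_of_mem (hE : 0 < finrank ℝ E) (hS : IsCompact S) (hSc : Convex ℝ S)
    {z : ℝ × E} (hz : z ∈ S) {p s : ℝ} (hp : 0 < sliceRoot μ S p) (hs : s ∈ Icc (0 : ℝ) 1) :
    s * sliceRoot μ S p ≤ sliceRoot μ S ((1 - s) * z.1 + s * p) := by
  have h := sliceRoot_concave (μ := μ) hE hS hSc (p := z.1) ⟨z.2, hz⟩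
    (slice_nonempty_of_sliceRoot_pos hE hp) (sub_nonneg.2 hs.2) hs.1 (sub_add_cancel _ _)
  have := mul_nonneg (sub_nonneg.2 hs.2) (sliceRoot_nonneg (μ := μ) (S := S) z.1)
  linarith

end SliceRoot

/-! ### Equality of volumes forces equality of superlevel sets -/

section SuperlevelSum

variable {E : Type*} [NormedAddCommGroup E] [NormedSpace ℝ E] [FiniteDimensional ℝ E]
  [MeasurableSpace E] [BorelSpace E] {μ : Measure E} [μ.IsAddHaarMeasure]

theorem exists_add_eq_of_le_sliceRoot (hE : 0 < finrank ℝ E) {A B : Set (ℝ × E)}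
    (hA : IsCompact A) (hB : IsCompact B) (hAc : Convex ℝ A) (hBc : Convex ℝ B)
    (hA1 : IsGreatest (range (sliceRoot μ A)) 1) (hB1 : IsGreatest (range (sliceRoot μ B)) 1)
    (hA2 : ∃ p q, p ≠ q ∧ 0 < sliceRoot μ A p ∧ 0 < sliceRoot μ A q)
    {α β : ℝ} (hα : 0 < α) (hβ : 0 < β) (hαβ : α + β = 1)
    (h : (volume.prod μ) (α • A + β • B) ≤
      ENNReal.ofReal α * (volume.prod μ) A + ENNReal.ofReal β * (volume.prod μ) B)
    {τ' τ : ℝ} (hτ' : 0 < τ') (hττ' : τ' < τ) {r : ℝ} (hr : τ ≤ sliceRoot μ (α • A + β • B) r) :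
    ∃ p q, τ' ≤ sliceRoot μ A p ∧ τ' ≤ sliceRoot μ B q ∧ α * p + β * q = r := by
  set C := α • A + β • B with hC
  have hCk : IsCompact C := (hA.smul α).add (hB.smul β)
  have hCc : Convex ℝ C := (hAc.smul α).add (hBc.smul β)
  set n : ℝ := (finrank ℝ E : ℝ) with hn
  have hn0 : 0 < n := by rw [hn]; positivity
  have hmax : ∀ S : Set (ℝ × E), IsGreatest (range (sliceRoot μ S)) 1 →
      IsGreatest (range fun p => μ.real (slice S p)) 1 := by
    rintro S ⟨⟨p, hp⟩, hS⟩
    refine ⟨⟨p, ?_⟩, ?_⟩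
    · have := Real.rpow_inv_eq (measureReal_nonneg (μ := μ) (s := slice S p)) zero_le_one hn0.ne'
      simpa using this.1 hp
    · rintro _ ⟨q, rfl⟩
      have := (Real.rpow_inv_le_iff_of_pos (measureReal_nonneg (μ := μ) (s := slice S q))
        zero_le_one hn0).1 (hS ⟨q, rfl⟩)
      simpa using this
  have hmin : ∀ p q, min (μ.real (slice A p)) (μ.real (slice B q)) ≤
      μ.real (slice C (α * p + β * q)) := by
    intro p q
    rcases (slice A p).eq_empty_or_nonempty with h0 | hp
    · simp [h0, measureReal_nonneg]
    rcases (slice B q).eq_empty_or_nonempty with h0 | hq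
    · simp [h0, measureReal_nonneg]
    exact ((min_le_rpow_mul_rpow measureReal_nonneg measureReal_nonneg hα hβ hαβ).trans
      (mulBrunnMinkowski μ (isCompact_slice hA p) (isCompact_slice hB q) hp hq hα hβ hαβ)).trans
      (measureReal_mono (slice_add_subset p q) (isCompact_slice hCk _).measure_ne_top)
  have hae := ae_superlevel_volume_eq hα hβ (fun p => measureReal_nonneg)
    (fun p => measureReal_nonneg) (fun p => measureReal_nonneg) (measurable_slice (μ := μ) hA)
    (measurable_slice (μ := μ) hB) (measurable_slice (μ := μ) hCk)
    (fun t ht => isCompact_superlevel_slice hA ht) (fun t ht => isCompact_superlevel_slice hB ht)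
    (hmax A hA1) (hmax B hB1) hmin
    (by rw [lintegral_slice hCk]; exact hCk.measure_ne_top)
    (by rw [lintegral_slice hCk, lintegral_slice hA, lintegral_slice hB]; exact h)
  rw [ae_restrict_iff' measurableSet_Ioi] at hae
  have hlt : τ' ^ n < τ ^ n := Real.rpow_lt_rpow hτ'.le hττ' hn0
  obtain ⟨t, htI, ht⟩ : ∃ t ∈ Ioo (τ' ^ n) (τ ^ n),
      ENNReal.ofReal α * volume {p | t ≤ μ.real (slice A p)} +
        ENNReal.ofReal β * volume {p | t ≤ μ.real (slice B p)} =
        volume {p | t ≤ μ.real (slice C p)} := by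
    by_contra! hcon
    have h0 : volume (Ioo (τ' ^ n) (τ ^ n)) = 0 := by
      refine measure_mono_null (fun t ht => ?_) hae
      intro himp
      exact hcon t ht (himp ((Real.rpow_pos_of_pos hτ' n).trans ht.1))
    rw [Real.volume_Ioo, ENNReal.ofReal_eq_zero] at h0
    linarith
  have ht0 : 0 < t := (Real.rpow_pos_of_pos hτ' n).trans htI.1
  set σ := t ^ n⁻¹ with hσ
  have hσ0 : 0 < σ := Real.rpow_pos_of_pos ht0 _
  have hσt : σ ^ n = t := Real.rpow_inv_rpow ht0.le hn0.ne'
  have hset : ∀ S : Set (ℝ × E), {p | t ≤ μ.real (slice S p)} = {p | σ ≤ sliceRoot μ S p} := by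
    intro S
    simp only [le_sliceRoot_iff hE hσ0.le, ← hn, hσt]
  rw [hset, hset, hset] at ht
  have hτ'σ : τ' < σ := (Real.lt_rpow_inv_iff_of_pos hτ'.le ht0.le hn0).2 htI.1
  have hστ : σ < τ := (Real.rpow_inv_lt_iff_of_pos ht0.le (hτ'.trans hττ').le hn0).2 htI.2
  have hrσ : r ∈ {p | σ ≤ sliceRoot μ C p} := hστ.le.trans hr
  have hsum : ∀ p q, 0 < sliceRoot μ A p → 0 < sliceRoot μ B q →
      α * sliceRoot μ A p + β * sliceRoot μ B q ≤ sliceRoot μ C (α * p + β * q) := fun p q hp hq =>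
    sliceRoot_add_le hE hA hB hCk (slice_nonempty_of_sliceRoot_pos hE hp)
      (slice_nonempty_of_sliceRoot_pos hE hq) hα.le hβ.le (slice_add_subset p q)
  obtain ⟨p₀, hp₀⟩ := hA1.1
  obtain ⟨q₀, hq₀⟩ := hB1.1
  obtain ⟨e, f, hef, hCI⟩ := superlevel_sliceRoot_eq_Icc hE hCk hCc hσ0 ⟨r, hrσ⟩
  rcases le_or_gt σ 1 with hσ1 | hσ1
  · obtain ⟨a, b, hab, hAI⟩ := superlevel_sliceRoot_eq_Icc (μ := μ) hE hA hAc hσ0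
      ⟨p₀, hσ1.trans hp₀.ge⟩
    obtain ⟨c, d, hcd, hBI⟩ := superlevel_sliceRoot_eq_Icc (μ := μ) hE hB hBc hσ0
      ⟨q₀, hσ1.trans hq₀.ge⟩
    have hmem : ∀ p ∈ Icc a b, ∀ q ∈ Icc c d, α * p + β * q ∈ Icc e f := by
      intro p hp q hq
      rw [← hAI] at hp
      rw [← hBI] at hq
      rw [← hCI]
      change σ ≤ _ at hp
      change σ ≤ _ at hq
      refine le_trans ?_ (hsum p q (hσ0.trans_le hp) (hσ0.trans_le hq))
      calc σ = α * σ + β * σ := by rw [← add_mul, hαβ, one_mul]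
        _ ≤ _ := by gcongr
    rw [hAI, hBI, hCI, Real.volume_Icc, Real.volume_Icc, Real.volume_Icc,
      ← ENNReal.ofReal_mul hα.le, ← ENNReal.ofReal_mul hβ.le, ← ENNReal.ofReal_add
        (mul_nonneg hα.le (sub_nonneg.2 hab)) (mul_nonneg hβ.le (sub_nonneg.2 hcd)),
      ENNReal.ofReal_eq_ofReal_iff (add_nonneg (mul_nonneg hα.le (sub_nonneg.2 hab))
        (mul_nonneg hβ.le (sub_nonneg.2 hcd))) (sub_nonneg.2 hef)] at ht
    have h1 := (hmem a (left_mem_Icc.2 hab) c (left_mem_Icc.2 hcd)).1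
    have h2 := (hmem b (right_mem_Icc.2 hab) d (right_mem_Icc.2 hcd)).2
    rw [hCI] at hrσ
    obtain ⟨θ, hθ, hθr⟩ : r ∈ (fun θ => α * (a + θ * (b - a)) + β * (c + θ * (d - c))) ''
        Icc (0 : ℝ) 1 := by
      refine intermediate_value_Icc zero_le_one (by fun_prop) ⟨?_, ?_⟩
      · linarith [hrσ.1]
      · linarith [hrσ.2]
    have hp : a + θ * (b - a) ∈ Icc a b := ⟨by nlinarith [hθ.1], by nlinarith [hθ.2]⟩
    have hq : c + θ * (d - c) ∈ Icc c d := ⟨by nlinarith [hθ.1], by nlinarith [hθ.2]⟩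
    rw [← hAI] at hp
    rw [← hBI] at hq
    exact ⟨_, _, hτ'σ.le.trans hp, hτ'σ.le.trans hq, hθr⟩
  · exfalso
    have hAe : {p | σ ≤ sliceRoot μ A p} = ∅ :=
      eq_empty_of_forall_notMem fun p hp => absurd (hp.trans (hA1.2 ⟨p, rfl⟩)) (not_le.2 hσ1)
    have hBe : {p | σ ≤ sliceRoot μ B p} = ∅ :=
      eq_empty_of_forall_notMem fun p hp => absurd (hp.trans (hB1.2 ⟨p, rfl⟩)) (not_le.2 hσ1)
    rw [hAe, hBe, hCI] at ht
    simp only [measure_empty, mul_zero, add_zero, Real.volume_Icc] at ht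
    have hfe : f = e := le_antisymm (by linarith [ENNReal.ofReal_eq_zero.1 ht.symm]) hef
    obtain ⟨r₁, hr₁, hr₁0⟩ : ∃ r₁, r₁ ≠ r ∧ 0 < sliceRoot μ C r₁ := by
      obtain ⟨p, q, hpq, hp, hq⟩ := hA2
      have h1 : ∀ p, 0 < sliceRoot μ A p → 0 < sliceRoot μ C (α * p + β * q₀) := fun p hp =>
        (by rw [hq₀]; positivity : 0 < α * sliceRoot μ A p + β * sliceRoot μ B q₀).trans_le
          (hsum p q₀ hp (by rw [hq₀]; exact one_pos))
      by_cases hpr : α * p + β * q₀ = r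
      · refine ⟨_, fun hqr => hpq ?_, h1 q hq⟩
        have : α * p = α * q := by linarith
        exact mul_left_cancel₀ hα.ne' this
      · exact ⟨_, hpr, h1 p hp⟩
    have hτ0 : 0 < τ := hτ'.trans hττ'
    set θ := σ / τ with hθ
    have hθ1 : θ < 1 := (div_lt_one hτ0).2 hστ
    have hθ0 : 0 < θ := div_pos hσ0 hτ0
    have h1 := sliceRoot_concave (μ := μ) hE hCk hCc (p := r) (q := r₁)
      (slice_nonempty_of_sliceRoot_pos hE (hτ0.trans_le hr))
      (slice_nonempty_of_sliceRoot_pos hE hr₁0) hθ0.le (sub_nonneg.2 hθ1.le) (by ring)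
    have h2 : σ ≤ sliceRoot μ C (θ * r + (1 - θ) * r₁) := by
      refine le_trans ?_ h1
      have h3 : θ * τ = σ := div_mul_cancel₀ _ hτ0.ne'
      have h4 : 0 ≤ (1 - θ) * sliceRoot μ C r₁ := mul_nonneg (sub_nonneg.2 hθ1.le) hr₁0.le
      nlinarith
    have h3 : θ * r + (1 - θ) * r₁ ∈ {p | σ ≤ sliceRoot μ C p} := h2
    rw [hCI, hfe, Icc_self, mem_singleton_iff] at h3
    rw [hCI, hfe, Icc_self, mem_singleton_iff] at hrσ
    have h4 : (1 - θ) * (r₁ - r) = 0 := by rw [hrσ]; rw [hrσ] at h3; linarith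
    rcases mul_eq_zero.1 h4 with h5 | h5
    · linarith
    · exact hr₁ (by linarith)

end SuperlevelSum

/-! ### Bodies with equality: the parts outside the plateau of maximal slices -/

theorem convex_slice {E : Type*} [AddCommGroup E] [Module ℝ E] {S : Set (ℝ × E)}
    (hS : Convex ℝ S) (p : ℝ) : Convex ℝ (slice S p) := fun x hx y hy s t hs ht hst => by
  have := hS hx hy hs ht hst
  rw [mem_slice]
  convert this using 1
  simp [← add_mul, hst]

section SliceEquality

variable {E : Type*} [NormedAddCommGroup E] [NormedSpace ℝ E] [MeasurableSpace E]

/-- The data describing equality in the Bonnesen inequality for `A`, `B` and `C = α A + β B`: every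
superlevel set of the slice volumes of `C` is the sum of those of `A` and `B`. -/
structure SliceEquality (μ : Measure E) (A B C : Set (ℝ × E)) (α β : ℝ) : Prop where
  left_pos : 0 < α
  right_pos : 0 < β
  add_eq_one : α + β = 1
  isCompact_left : IsCompact A
  isCompact_right : IsCompact B
  isCompact_sum : IsCompact C
  convex_left : Convex ℝ A
  convex_right : Convex ℝ B
  convex_sum : Convex ℝ C
  isGreatest_left : IsGreatest (range (sliceRoot μ A)) 1
  isGreatest_right : IsGreatest (range (sliceRoot μ B)) 1
  slice_subset : ∀ p q, α • slice A p + β • slice B q ⊆ slice C (α * p + β * q)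
  exists_add_eq : ∀ τ' τ, 0 < τ' → τ' < τ → ∀ r, τ ≤ sliceRoot μ C r →
    ∃ p q, τ' ≤ sliceRoot μ A p ∧ τ' ≤ sliceRoot μ B q ∧ α * p + β * q = r

/-- The reflection of `S ⊆ ℝ × E` in the horizontal hyperplane `{0} × E`. -/
def reflect {E : Type*} (S : Set (ℝ × E)) : Set (ℝ × E) := (fun z => (-z.1, z.2)) ⁻¹' S

theorem slice_reflect {E : Type*} (S : Set (ℝ × E)) (p : ℝ) :
    slice (reflect S) p = slice S (-p) := rfl

theorem isCompact_reflect {E : Type*} [NormedAddCommGroup E] {S : Set (ℝ × E)}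
    (hS : IsCompact S) : IsCompact (reflect S) := by
  have : reflect S = (fun z : ℝ × E => (-z.1, z.2)) '' S := by
    ext z
    refine ⟨fun hz => ⟨_, hz, by simp⟩, ?_⟩
    rintro ⟨w, hw, rfl⟩
    simpa [reflect] using hw
  rw [this]
  exact hS.image (by fun_prop)

theorem convex_reflect {E : Type*} [AddCommGroup E] [Module ℝ E] {S : Set (ℝ × E)}
    (hS : Convex ℝ S) : Convex ℝ (reflect S) := by
  intro x hx y hy s t hs ht hst
  have h := hS hx hy hs ht hst
  change (-(s • x + t • y).1, (s • x + t • y).2) ∈ S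
  have : (-(s • x + t • y).1, (s • x + t • y).2) = s • (-x.1, x.2) + t • (-y.1, y.2) := by
    ext <;> simp [add_comm]
  rw [this]
  exact h

theorem range_sliceRoot_reflect (μ : Measure E) (S : Set (ℝ × E)) :
    range (sliceRoot μ (reflect S)) = range (sliceRoot μ S) :=
  (Equiv.neg ℝ).surjective.range_comp (sliceRoot μ S)

variable {μ : Measure E} {A B C : Set (ℝ × E)} {α β : ℝ}

theorem SliceEquality.symm (h : SliceEquality μ A B C α β) : SliceEquality μ B A C β α where
  left_pos := h.right_pos
  right_pos := h.left_pos
  add_eq_one := by rw [add_comm, h.add_eq_one]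
  isCompact_left := h.isCompact_right
  isCompact_right := h.isCompact_left
  isCompact_sum := h.isCompact_sum
  convex_left := h.convex_right
  convex_right := h.convex_left
  convex_sum := h.convex_sum
  isGreatest_left := h.isGreatest_right
  isGreatest_right := h.isGreatest_left
  slice_subset p q := by rw [add_comm, add_comm (β * p)]; exact h.slice_subset q p
  exists_add_eq τ' τ hτ' hτ r hr := by
    obtain ⟨p, q, hp, hq, hpq⟩ := h.exists_add_eq τ' τ hτ' hτ r hr
    exact ⟨q, p, hq, hp, by rw [add_comm, hpq]⟩

theorem SliceEquality.reflect (h : SliceEquality μ A B C α β) :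
    SliceEquality μ (reflect A) (reflect B) (reflect C) α β where
  left_pos := h.left_pos
  right_pos := h.right_pos
  add_eq_one := h.add_eq_one
  isCompact_left := isCompact_reflect h.isCompact_left
  isCompact_right := isCompact_reflect h.isCompact_right
  isCompact_sum := isCompact_reflect h.isCompact_sum
  convex_left := convex_reflect h.convex_left
  convex_right := convex_reflect h.convex_right
  convex_sum := convex_reflect h.convex_sum
  isGreatest_left := by rw [range_sliceRoot_reflect]; exact h.isGreatest_left
  isGreatest_right := by rw [range_sliceRoot_reflect]; exact h.isGreatest_right
  slice_subset p q := by
    rw [slice_reflect, slice_reflect, slice_reflect, neg_add, ← mul_neg, ← mul_neg]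
    exact h.slice_subset (-p) (-q)
  exists_add_eq τ' τ hτ' hτ r hr := by
    obtain ⟨p, q, hp, hq, hpq⟩ := h.exists_add_eq τ' τ hτ' hτ (-r) hr
    refine ⟨-p, -q, ?_, ?_, by linarith⟩
    · simpa [sliceRoot, slice_reflect] using hp
    · simpa [sliceRoot, slice_reflect] using hq

theorem SliceEquality.sliceRoot_le_one (h : SliceEquality μ A B C α β) (r : ℝ) :
    sliceRoot μ C r ≤ 1 := by
  by_contra! hr
  obtain ⟨p, q, hp, -, -⟩ := h.exists_add_eq ((1 + sliceRoot μ C r) / 2) _ (by linarith)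
    (by linarith) r le_rfl
  linarith [h.isGreatest_left.2 ⟨p, rfl⟩]

variable [FiniteDimensional ℝ E] [BorelSpace E] [μ.IsAddHaarMeasure]

namespace SliceEquality

theorem le_sliceRoot_add (h : SliceEquality μ A B C α β) (hE : 0 < finrank ℝ E) {p q : ℝ}
    (hp : 0 < sliceRoot μ A p) (hq : 0 < sliceRoot μ B q) :
    α * sliceRoot μ A p + β * sliceRoot μ B q ≤ sliceRoot μ C (α * p + β * q) :=
  sliceRoot_add_le hE h.isCompact_left h.isCompact_right h.isCompact_sum
    (slice_nonempty_of_sliceRoot_pos hE hp) (slice_nonempty_of_sliceRoot_pos hE hq)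
    h.left_pos.le h.right_pos.le (h.slice_subset p q)

theorem slice_eq (h : SliceEquality μ A B C α β) (hE : 0 < finrank ℝ E) {p q : ℝ}
    (hp : 0 < sliceRoot μ A p) (hpq : sliceRoot μ B q = sliceRoot μ A p)
    (hle : sliceRoot μ C (α * p + β * q) ≤ sliceRoot μ A p) :
    (∃ x : E, slice B q = x +ᵥ slice A p) ∧
      α • slice A p + β • slice B q = slice C (α * p + β * q) := by
  have hinv : 0 < (finrank ℝ E : ℝ)⁻¹ := by positivity
  have hAk := isCompact_slice h.isCompact_left p
  have hBk := isCompact_slice h.isCompact_right q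
  have hCk := isCompact_slice h.isCompact_sum (α * p + β * q)
  have h1 : μ.real (slice B q) = μ.real (slice A p) :=
    (Real.rpow_left_inj measureReal_nonneg measureReal_nonneg hinv.ne').1 hpq
  have h2 : μ.real (slice C (α * p + β * q)) ≤ μ.real (slice A p) :=
    (Real.rpow_le_rpow_iff measureReal_nonneg measureReal_nonneg hinv).1 hle
  have hsub := h.slice_subset p q
  have h3 := measureReal_mono (μ := μ) hsub hCk.measure_ne_top
  have hpos := measureReal_slice_pos hE hp
  refine ⟨exists_eq_vadd_of_measureReal_add_le hE hAk hBk (convex_slice h.convex_left p)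
    (convex_slice h.convex_right q) hpos h1 h.left_pos h.right_pos
    h.add_eq_one (h3.trans h2), ?_⟩
  have h4 := brunnMinkowski μ hE hAk hBk (slice_nonempty_of_sliceRoot_pos hE hp)
    (slice_nonempty_of_sliceRoot_pos hE (hpq ▸ hp)) h.left_pos h.right_pos
  rw [h1, ← add_mul, h.add_eq_one, one_mul,
    Real.rpow_le_rpow_iff measureReal_nonneg measureReal_nonneg hinv] at h4
  exact eq_of_subset_of_measureReal_le (μ := μ) ((hAk.smul α).add (hBk.smul β)).isClosed hCk
    (convex_slice h.convex_sum _) (hpos.trans_le (h4.trans h3)) hsub (h2.trans h4)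

end SliceEquality

end SliceEquality

section LeftPart

variable {E : Type*} [NormedAddCommGroup E] [NormedSpace ℝ E] [MeasurableSpace E]
  [FiniteDimensional ℝ E] [BorelSpace E] {μ : Measure E} [μ.IsAddHaarMeasure]
  {A B C : Set (ℝ × E)} {α β : ℝ}

theorem exists_forall_lt_of_lt_isLeast (hE : 0 < finrank ℝ E) {S : Set (ℝ × E)}
    (hS : IsCompact S) (hSc : Convex ℝ S) {a p : ℝ} (ha : IsLeast {p | 1 ≤ sliceRoot μ S p} a)
    (hp : p < a) : ∃ τ ∈ Ioo (0 : ℝ) 1, ∀ q, τ ≤ sliceRoot μ S q → p < q := by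
  have hp1 : sliceRoot μ S p < 1 := by
    by_contra! h1
    exact absurd (ha.2 h1) (not_le.2 hp)
  have hp0 := sliceRoot_nonneg (μ := μ) (S := S) p
  refine ⟨(1 + sliceRoot μ S p) / 2, ⟨by linarith, by linarith⟩, fun q hq => ?_⟩
  by_contra! hqp
  have := le_sliceRoot_of_mem_Icc hE hS hSc (by linarith) hq
    (le_trans (by linarith) ha.1) hqp hp.le
  linarith

namespace SliceEquality

theorem sliceRoot_shift (h : SliceEquality μ A B C α β) (hE : 0 < finrank ℝ E) {a₁ c₁ : ℝ}
    (ha₁ : IsLeast {p | 1 ≤ sliceRoot μ A p} a₁) (hc₁ : IsLeast {p | 1 ≤ sliceRoot μ B p} c₁)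
    {p : ℝ} (hp : p ≤ a₁) : sliceRoot μ B (p + (c₁ - a₁)) = sliceRoot μ A p ∧
      sliceRoot μ C (α * p + β * (p + (c₁ - a₁))) ≤ sliceRoot μ A p := by
  have hex : ∀ S : Set (ℝ × E), IsCompact S → (∃ p, 1 ≤ sliceRoot μ S p) →
      ∀ τ : ℝ, ∃ a, τ ∈ Ioo (0 : ℝ) 1 → IsLeast {p | τ ≤ sliceRoot μ S p} a := by
    rintro S hS ⟨p, hp⟩ τ
    by_cases hτ : τ ∈ Ioo (0 : ℝ) 1
    · obtain ⟨a, ha⟩ := (isCompact_superlevel_sliceRoot (μ := μ) hE hS hτ.1).exists_isLeast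
        ⟨p, hτ.2.le.trans hp⟩
      exact ⟨a, fun _ => ha⟩
    · exact ⟨0, fun h => absurd h hτ⟩
  choose a ha using hex A h.isCompact_left ⟨a₁, ha₁.1⟩
  choose c hc using hex B h.isCompact_right ⟨c₁, hc₁.1⟩
  have hconc : ∀ S : Set (ℝ × E), IsCompact S → Convex ℝ S → ∀ p q, 0 < sliceRoot μ S p →
      0 < sliceRoot μ S q → ∀ s t : ℝ, 0 ≤ s → 0 ≤ t → s + t = 1 →
      s * sliceRoot μ S p + t * sliceRoot μ S q ≤ sliceRoot μ S (s * p + t * q) :=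
    fun S hS hSc p q hp hq s t hs ht hst => sliceRoot_concave hE hS hSc
      (slice_nonempty_of_sliceRoot_pos hE hp) (slice_nonempty_of_sliceRoot_pos hE hq) hs ht hst
  have hmid : (1 / 2 : ℝ) ∈ Ioo (0 : ℝ) 1 := by norm_num
  have hα := h.left_pos
  have hβ := h.right_pos
  have hquant : ∀ τ ∈ Ioo (0 : ℝ) 1, c τ = a τ + (c (1 / 2) - a (1 / 2)) := by
    intro τ hτ
    have := quantile_sub_eq h.left_pos h.right_pos h.add_eq_one ha hc
      (hconc A h.isCompact_left h.convex_left) (hconc B h.isCompact_right h.convex_right)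
      (H := sliceRoot μ C) (fun p q hp hq => h.le_sliceRoot_add hE hp hq) ?_ hτ hmid
    · linarith
    · intro τ' hτ' τ hττ' r hr
      obtain ⟨p, q, hp, hq, rfl⟩ := h.exists_add_eq τ' τ hτ'.1 hττ' r hr
      have h1 := (ha τ' hτ').2 hp
      have h2 := (hc τ' hτ').2 hq
      gcongr
  have hk : c (1 / 2) - a (1 / 2) = c₁ - a₁ := by
    refine le_antisymm ?_ ?_
    · by_contra! hlt
      obtain ⟨τ, hτ, hτa⟩ := exists_forall_lt_of_lt_isLeast hE h.isCompact_left h.convex_left ha₁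
        (p := c₁ - (c (1 / 2) - a (1 / 2))) (by linarith)
      have h1 := hτa _ (ha τ hτ).1
      have h2 := (hc τ hτ).2 (hτ.2.le.trans hc₁.1)
      linarith [hquant τ hτ]
    · by_contra! hlt
      obtain ⟨τ, hτ, hτa⟩ := exists_forall_lt_of_lt_isLeast hE h.isCompact_right h.convex_right hc₁
        (p := a₁ + (c (1 / 2) - a (1 / 2))) (by linarith)
      have h1 := hτa _ (hc τ hτ).1
      have h2 := (ha τ hτ).2 (hτ.2.le.trans ha₁.1)
      linarith [hquant τ hτ]
  rw [hk] at hquant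
  constructor
  · refine le_antisymm (le_of_forall_lt_imp_le_of_dense fun τ hτ => ?_)
      (le_of_forall_lt_imp_le_of_dense fun τ hτ => ?_)
    · rcases le_or_gt τ 0 with h0 | h0
      · exact h0.trans (sliceRoot_nonneg _)
      have hτI : τ ∈ Ioo (0 : ℝ) 1 := ⟨h0, hτ.trans_le (h.isGreatest_right.2 ⟨_, rfl⟩)⟩
      have h1 := (hc τ hτI).2 hτ.le
      rw [hquant τ hτI] at h1
      exact le_sliceRoot_of_mem_Icc hE h.isCompact_left h.convex_left h0 (ha τ hτI).1
        (hτI.2.le.trans ha₁.1) (by linarith) hp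
    · rcases le_or_gt τ 0 with h0 | h0
      · exact h0.trans (sliceRoot_nonneg _)
      have hτI : τ ∈ Ioo (0 : ℝ) 1 := ⟨h0, hτ.trans_le (h.isGreatest_left.2 ⟨_, rfl⟩)⟩
      have h1 := (ha τ hτI).2 hτ.le
      exact le_sliceRoot_of_mem_Icc hE h.isCompact_right h.convex_right h0 (hc τ hτI).1
        (hτI.2.le.trans hc₁.1) (by rw [hquant τ hτI]; linarith) (by linarith)
  · rcases hp.eq_or_lt with rfl | hp
    · exact (h.sliceRoot_le_one _).trans ha₁.1
    by_contra! hlt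
    have hp1 : sliceRoot μ A p < 1 := by
      by_contra! h1
      exact absurd (ha₁.2 h1) (not_le.2 hp)
    obtain ⟨τ, hτ1, hτ2⟩ := exists_between (lt_min hlt hp1)
    have hτ0 : 0 < τ := (sliceRoot_nonneg _).trans_lt hτ1
    have hτI : τ ∈ Ioo (0 : ℝ) 1 := ⟨hτ0, hτ2.trans_le (min_le_right _ _)⟩
    obtain ⟨p', q', hp', hq', hpq⟩ := h.exists_add_eq τ _ hτ0 (hτ2.trans_le (min_le_left _ _)) _
      le_rfl
    have h1 := (ha τ hτI).2 hp'
    have h2 := (hc τ hτI).2 hq'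
    rw [hquant τ hτI] at h2
    have h3 : a τ ≤ p := by
      have h4 : α * a τ + β * (a τ + (c₁ - a₁)) ≤ α * p + β * (p + (c₁ - a₁)) := by
        rw [← hpq]; gcongr
      have h5 : (α + β) * a τ ≤ (α + β) * p := by linarith
      rwa [h.add_eq_one, one_mul, one_mul] at h5
    exact absurd (le_sliceRoot_of_mem_Icc hE h.isCompact_left h.convex_left hτ0 (ha τ hτI).1
      (hτI.2.le.trans ha₁.1) h3 hp.le) (not_le.2 hτ1)

end SliceEquality

/-- A point of `A` below height `a₁` is a limit of points whose slices contain interior heights. -/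
theorem add_mem_of_forall_slice_subset (hE : 0 < finrank ℝ E) (hA : IsCompact A)
    (hAc : Convex ℝ A) (hB : IsClosed B) {a₁ k : ℝ} {x : E}
    (hsl : ∀ p < a₁, (∃ q < p, 0 < sliceRoot μ A q) → x +ᵥ slice A p ⊆ slice B (p + k))
    {u : ℝ} (hu : u < a₁) (hqu : ∃ q < u, 0 < sliceRoot μ A q) {z : ℝ × E} (hz : z ∈ A)
    (hza : z.1 ≤ a₁) (hu0 : 0 < sliceRoot μ A u) : z + (k, x) ∈ B := by
  obtain ⟨y, hy⟩ := slice_nonempty_of_sliceRoot_pos hE hu0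
  have hmem : ∀ᶠ s in 𝓝[>] (0 : ℝ), (1 - s) • z + s • ((u, y) : ℝ × E) + (k, x) ∈ B := by
    filter_upwards [Ioo_mem_nhdsGT (zero_lt_one : (0 : ℝ) < 1)] with s hs
    have hws : (1 - s) • z + s • ((u, y) : ℝ × E) ∈ A :=
      hAc hz hy (by linarith [hs.2]) hs.1.le (by ring)
    set w := (1 - s) • z + s • ((u, y) : ℝ × E) with hw
    have hw1 : w.1 = (1 - s) * z.1 + s * u := by simp [hw]
    have hlt : w.1 < a₁ := by rw [hw1]; nlinarith [hs.1, hs.2]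
    have hq : ∃ q < w.1, 0 < sliceRoot μ A q := by
      rcases le_or_gt u z.1 with hle | hgt
      · obtain ⟨q, hq, hq0⟩ := hqu
        refine ⟨q, ?_, hq0⟩
        rw [hw1]
        nlinarith [hs.1, hs.2]
      · refine ⟨(1 - s / 2) * z.1 + s / 2 * u, by rw [hw1]; nlinarith [hs.1], ?_⟩
        have := mul_sliceRoot_le_of_mem hE hA hAc hz hu0 (s := s / 2)
          ⟨by linarith [hs.1], by linarith [hs.2]⟩
        exact lt_of_lt_of_le (mul_pos (by linarith [hs.1]) hu0) this
    have := hsl _ hlt hq (vadd_mem_vadd_set (show w.2 ∈ slice A w.1 from hws))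
    rw [vadd_eq_add, mem_slice] at this
    convert this using 1
    ext <;> simp [add_comm]
  have hlim : Tendsto (fun s : ℝ => (1 - s) • z + s • ((u, y) : ℝ × E) + (k, x)) (𝓝[>] 0)
      (𝓝 (z + (k, x))) := by
    have : Continuous fun s : ℝ => (1 - s) • z + s • ((u, y) : ℝ × E) + (k, x) := by fun_prop
    have h2 := this.tendsto 0
    simp only [sub_zero, one_smul, zero_smul, add_zero] at h2
    exact h2.mono_left nhdsWithin_le_nhds
  exact hB.mem_of_tendsto hlim hmem

namespace SliceEquality

theorem exists_shift_left (h : SliceEquality μ A B C α β) (hE : 0 < finrank ℝ E) {a₁ c₁ : ℝ}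
    (ha₁ : IsLeast {p | 1 ≤ sliceRoot μ A p} a₁) (hc₁ : IsLeast {p | 1 ≤ sliceRoot μ B p} c₁) :
    ∃ x : E, ∀ z : ℝ × E, z.1 ≤ a₁ → (z ∈ A ↔ z + (c₁ - a₁, x) ∈ B) := by
  set k := c₁ - a₁ with hk
  have hα := h.left_pos
  have hβ := h.right_pos
  have hshift : ∀ p ≤ a₁, _ := fun p hp => h.sliceRoot_shift hE ha₁ hc₁ hp
  have hsl : ∀ p : ℝ, ∃ x : E, p ≤ a₁ → 0 < sliceRoot μ A p →
      slice B (p + k) = x +ᵥ slice A p ∧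
        α • slice A p + β • slice B (p + k) = slice C (α * p + β * (p + k)) := by
    intro p
    by_cases hp : p ≤ a₁ ∧ 0 < sliceRoot μ A p
    · obtain ⟨⟨x, hx⟩, hsum⟩ := h.slice_eq hE hp.2 (hshift p hp.1).1 (hshift p hp.1).2
      exact ⟨x, fun _ _ => ⟨hx, hsum⟩⟩
    · exact ⟨0, fun h1 h2 => absurd ⟨h1, h2⟩ hp⟩
  choose x hx using hsl
  set U : Set ℝ := {p | p < a₁ ∧ ∃ q < p, 0 < sliceRoot μ A q} with hU
  have hpos : ∀ p ∈ U, 0 < sliceRoot μ A p := by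
    rintro p ⟨hp, q, hq, hq0⟩
    exact (lt_min hq0 one_pos).trans_le (le_sliceRoot_of_mem_Icc hE h.isCompact_left h.convex_left
      (lt_min hq0 one_pos) (min_le_left _ _) ((min_le_right _ _).trans ha₁.1) hq.le hp.le)
  by_cases hUne : U.Nonempty
  · have hUo : IsOpen U := by
      have : U = Iio a₁ ∩ ⋃ q ∈ {q | 0 < sliceRoot μ A q}, Ioi q := by
        ext p
        simp only [hU, mem_ofPred_eq, mem_inter_iff, mem_Iio, mem_iUnion, mem_Ioi, exists_prop]
        tauto
      rw [this]
      exact isOpen_Iio.inter (isOpen_biUnion fun q _ => isOpen_Ioi)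
    have hUc : U.OrdConnected := by
      refine ⟨fun p hp q hq r hr => ⟨hr.2.trans_lt hq.1, ?_⟩⟩
      obtain ⟨q', hq', h0⟩ := hp.2
      exact ⟨q', hq'.trans_le hr.1, h0⟩
    have hconst : ∀ p ∈ U, ∀ q ∈ U, x p = x q := by
      intro p hp q hq
      refine (SeparatingDual.eq_iff_forall_dual_eq (R := ℝ)).2 fun ℓ => ?_
      set φ : ℝ → ℝ := fun p => sSup (ℓ '' slice A p) with hφ
      set ψ : ℝ → ℝ := fun p => sSup (ℓ '' slice B (p + k)) with hψ
      have hne : ∀ p ∈ U, (slice A p).Nonempty := fun p hp =>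
        slice_nonempty_of_sliceRoot_pos hE (hpos p hp)
      have hne' : ∀ p ∈ U, (slice B (p + k)).Nonempty := fun p hp => by
        rw [(hx p hp.1.le (hpos p hp)).1]
        exact (hne p hp).vadd_set
      have hg : ∀ p ∈ U, IsGreatest (ℓ '' slice A p) (φ p) := fun p hp =>
        ((isCompact_slice h.isCompact_left p).image ℓ.continuous).isGreatest_sSup
          ((hne p hp).image _)
      have hg' : ∀ p ∈ U, IsGreatest (ℓ '' slice B (p + k)) (ψ p) := fun p hp =>
        ((isCompact_slice h.isCompact_right _).image ℓ.continuous).isGreatest_sSup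
          ((hne' p hp).image _)
      have hUconv : Convex ℝ U := hUc.convex
      have hφc : ContinuousOn φ U := by
        refine ConcaveOn.continuousOn hUo ⟨hUconv, fun p hp q hq s t hs ht hst => ?_⟩
        obtain ⟨y, hy, hyp⟩ := (hg p hp).1
        obtain ⟨y', hy', hyq⟩ := (hg q hq).1
        rw [← hyp, ← hyq]
        refine (hg _ (hUconv hp hq hs ht hst)).2 ⟨s • y + t • y', ?_, by simp⟩
        exact smul_slice_add_subset h.convex_left p q hs ht hst
          (add_mem_add (smul_mem_smul_set hy) (smul_mem_smul_set hy'))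
      have hψc : ContinuousOn ψ U := by
        refine ConcaveOn.continuousOn hUo ⟨hUconv, fun p hp q hq s t hs ht hst => ?_⟩
        obtain ⟨y, hy, hyp⟩ := (hg' p hp).1
        obtain ⟨y', hy', hyq⟩ := (hg' q hq).1
        rw [← hyp, ← hyq]
        refine (hg' _ (hUconv hp hq hs ht hst)).2 ⟨s • y + t • y', ?_, by simp⟩
        have := smul_slice_add_subset h.convex_right (p + k) (q + k) hs ht hst
          (add_mem_add (smul_mem_smul_set hy) (smul_mem_smul_set hy'))
        have e : s * (p + k) + t * (q + k) = s • p + t • q + k := by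
          simp only [smul_eq_mul]; linear_combination k * hst
        rwa [e] at this
      have key := sub_eq_sub_of_forall_add_le hUo hUc hφc hψc hα hβ h.add_eq_one ?_ hp hq
      · have hψφ : ∀ p ∈ U, ψ p = φ p + ℓ (x p) := by
          intro p hp
          refine (hg' p hp).unique ?_
          rw [(hx p hp.1.le (hpos p hp)).1]
          obtain ⟨⟨y, hy, hyp⟩, hmax⟩ := hg p hp
          refine ⟨⟨x p + y, vadd_mem_vadd_set hy, by rw [map_add, hyp, add_comm]⟩, ?_⟩
          rintro _ ⟨_, ⟨y', hy', rfl⟩, rfl⟩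
          have := hmax ⟨y', hy', rfl⟩
          simp only [vadd_eq_add, map_add]
          linarith
        rw [hψφ p hp, hψφ q hq] at key
        linarith
      intro p hp q hq
      obtain ⟨y, hy, hyp⟩ := (hg p hp).1
      obtain ⟨y', hy', hyq⟩ := (hg' q hq).1
      set m := α * p + β * q with hm
      have hmU : m ∈ U := hUconv hp hq hα.le hβ.le h.add_eq_one
      have h1 := h.slice_subset p (q + k)
        (add_mem_add (smul_mem_smul_set hy) (smul_mem_smul_set hy'))
      have e : α * p + β * (q + k) = α * m + β * (m + k) := by
        rw [hm]; linear_combination -(α * p + β * q) * h.add_eq_one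
      rw [e, ← (hx m hmU.1.le (hpos m hmU)).2] at h1
      obtain ⟨_, ⟨w, hw, rfl⟩, _, ⟨w', hw', rfl⟩, hsum⟩ := h1
      have h2 := congrArg ℓ hsum
      simp only [map_add, map_smul, smul_eq_mul, hyp, hyq] at h2
      rw [← h2]
      have h3 := (hg m hmU).2 ⟨w, hw, rfl⟩
      have h4 := (hg' m hmU).2 ⟨w', hw', rfl⟩
      gcongr
    obtain ⟨u, hu⟩ := hUne
    have hsub : ∀ p ∈ U, slice B (p + k) = x u +ᵥ slice A p := fun p hp => by
      rw [(hx p hp.1.le (hpos p hp)).1, hconst p hp u hu]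
    refine ⟨x u, fun z hz => ⟨fun hzA => ?_, fun hzB => ?_⟩⟩
    · exact add_mem_of_forall_slice_subset hE h.isCompact_left h.convex_left
        h.isCompact_right.isClosed (fun p hp hq => (hsub p ⟨hp, hq⟩).ge) hu.1 hu.2 hzA hz
        (hpos u hu)
    · have hroot : ∀ p ≤ c₁, sliceRoot μ A (p - k) = sliceRoot μ B p := fun p hp => by
        have := (hshift (p - k) (by linarith)).1
        rw [sub_add_cancel] at this
        exact this.symm
      have hBU : ∀ p, p < c₁ → (∃ q < p, 0 < sliceRoot μ B q) → p - k ∈ U := by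
        rintro p hp ⟨q, hq, hq0⟩
        exact ⟨by linarith, q - k, by linarith, by rw [hroot q (by linarith)]; exact hq0⟩
      have hq : ∃ q < u + k, 0 < sliceRoot μ B q := by
        obtain ⟨q, hq, hq0⟩ := hu.2
        refine ⟨q + k, by linarith, ?_⟩
        rw [← hroot (q + k) (by linarith [hu.1]), add_sub_cancel_right]
        exact hq0
      have := add_mem_of_forall_slice_subset (μ := μ) (a₁ := c₁) (k := -k) (x := -x u)
        (u := u + k) hE h.isCompact_right h.convex_right h.isCompact_left.isClosed
        (fun p hp hq => ?_) (by linarith [hu.1]) hq hzB (by simp; linarith)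
        (by rw [(hshift u hu.1.le).1]; exact hpos u hu)
      · convert this using 1
        ext <;> simp
      · have h1 := hsub _ (hBU p hp hq)
        rw [sub_add_cancel] at h1
        rw [h1, neg_vadd_vadd, ← sub_eq_add_neg]
  · have hA0 : ∀ z ∈ A, z.1 ≤ a₁ → z.1 = a₁ := by
      intro z hz hza
      refine hza.eq_of_not_lt fun hlt => hUne ?_
      have hpos1 : 0 < sliceRoot μ A a₁ := one_pos.trans_le ha₁.1
      refine ⟨(1 - 2⁻¹) * z.1 + 2⁻¹ * a₁, by linarith, (1 - 4⁻¹) * z.1 + 4⁻¹ * a₁, by linarith, ?_⟩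
      exact (mul_pos (by norm_num) hpos1).trans_le
        (mul_sliceRoot_le_of_mem hE h.isCompact_left h.convex_left hz hpos1 (by norm_num))
    have hB0 : ∀ z ∈ B, z.1 ≤ c₁ → z.1 = c₁ := by
      intro z hz hza
      refine hza.eq_of_not_lt fun hlt => hUne ?_
      have hpos1 : 0 < sliceRoot μ B c₁ := one_pos.trans_le hc₁.1
      refine ⟨(1 - 2⁻¹) * z.1 + 2⁻¹ * c₁ - k, by linarith,
        (1 - 4⁻¹) * z.1 + 4⁻¹ * c₁ - k, by linarith, ?_⟩
      rw [← (hshift _ (by linarith)).1, sub_add_cancel]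
      exact (mul_pos (by norm_num) hpos1).trans_le
        (mul_sliceRoot_le_of_mem hE h.isCompact_right h.convex_right hz hpos1 (by norm_num))
    have h1 := (hx a₁ le_rfl (one_pos.trans_le ha₁.1)).1
    have h2 : ∀ y, (a₁, y) ∈ A ↔ (a₁, y) + (k, x a₁) ∈ B := by
      intro y
      have : (a₁, y) + (k, x a₁) ∈ B ↔ x a₁ +ᵥ y ∈ slice B (a₁ + k) := by
        rw [mem_slice, vadd_eq_add, add_comm (x a₁), Prod.mk_add_mk]
      rw [this, h1, vadd_mem_vadd_set_iff, mem_slice]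
    refine ⟨x a₁, fun ⟨p, y⟩ hz => ⟨fun hzA => ?_, fun hzB => ?_⟩⟩
    · obtain rfl : p = a₁ := hA0 _ hzA hz
      exact (h2 y).1 hzA
    · have h3 := hB0 _ hzB (by simp at hz ⊢; linarith)
      obtain rfl : p = a₁ := by simp at h3; linarith
      exact (h2 y).2 hzB

end SliceEquality

end LeftPart

/-! ### The plateau of maximal slices and the structure of bodies with equality -/

section Translates

variable {E : Type*} [NormedAddCommGroup E] [NormedSpace ℝ E]

theorem smul_vadd_add_smul_vadd {K : Set E} (hK : Convex ℝ K) {s t : ℝ} (hs : 0 ≤ s) (ht : 0 ≤ t)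
    (hst : s + t = 1) (a b : E) : s • (a +ᵥ K) + t • (b +ᵥ K) = (s • a + t • b) +ᵥ K := by
  have h := hK.add_smul hs ht
  rw [hst, one_smul] at h
  ext y
  constructor
  · rintro ⟨_, ⟨_, ⟨x, hx, rfl⟩, rfl⟩, _, ⟨_, ⟨x', hx', rfl⟩, rfl⟩, rfl⟩
    refine ⟨s • x + t • x', hK hx hx' hs ht hst, ?_⟩
    simp only [vadd_eq_add, smul_add]
    abel
  · rintro ⟨x, hx, rfl⟩
    refine ⟨_, ⟨_, ⟨x, hx, rfl⟩, rfl⟩, _, ⟨_, ⟨x, hx, rfl⟩, rfl⟩, ?_⟩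
    have : s • x + t • x = x := by rw [← add_smul, hst, one_smul]
    simp only [vadd_eq_add, smul_add]
    nth_rewrite 3 [← this]
    abel

theorem eq_of_vadd_subset_vadd {K : Set E} (hK : IsCompact K) (hne : K.Nonempty) {a b : E}
    (h : a +ᵥ K ⊆ b +ᵥ K) : a = b := by
  have hle : ∀ ℓ : E →L[ℝ] ℝ, ℓ a ≤ ℓ b := by
    intro ℓ
    obtain ⟨y, hy, hmax⟩ := hK.exists_isMaxOn hne ℓ.continuous.continuousOn
    obtain ⟨y', hy', hyy'⟩ := h ⟨y, hy, rfl⟩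
    have h1 := congrArg ℓ hyy'
    simp only [vadd_eq_add, map_add] at h1
    have h2 : ℓ y' ≤ ℓ y := hmax hy'
    linarith
  refine (SeparatingDual.eq_iff_forall_dual_eq (R := ℝ)).2 fun ℓ => (hle ℓ).antisymm ?_
  have := hle (-ℓ)
  simpa using this

theorem mem_of_forall_smul_add_mem {K : Set E} (hK : IsClosed K) (hne : K.Nonempty) {y : E}
    {θ : ℝ} (hθ0 : 0 < θ) (hθ1 : θ ≤ 1) (h : ∀ k ∈ K, θ • y + (1 - θ) • k ∈ K) : y ∈ K := by
  obtain ⟨k, hk⟩ := hne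
  have hmem : ∀ n : ℕ, y + (1 - θ) ^ n • (k - y) ∈ K := by
    intro n
    induction n with
    | zero => simpa using hk
    | succ n ih =>
      have e : y + (1 - θ) ^ (n + 1) • (k - y) =
          θ • y + (1 - θ) • (y + (1 - θ) ^ n • (k - y)) := by
        rw [pow_succ, mul_comm, mul_smul]
        module
      rw [e]
      exact h _ ih
  have hlim : Tendsto (fun n : ℕ => y + (1 - θ) ^ n • (k - y)) atTop (𝓝 (y + (0 : ℝ) • (k - y))) :=
    ((tendsto_pow_atTop_nhds_zero_of_lt_one (by linarith) (by linarith)).smul_const _).const_add _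
  rw [zero_smul, add_zero] at hlim
  exact hK.mem_of_tendsto hlim (Eventually.of_forall hmem)

/-- If a convex set contains a cylinder with base `K` and axis direction `(1, w)` as its part over
an interval of positive length, then it projects along `(1, w)` onto the base. -/
theorem mem_of_slice_eq_vadd {K : Set E} (hK : IsClosed K) (hKne : K.Nonempty) {S : Set (ℝ × E)}
    (hS : Convex ℝ S) {c d : ℝ} (hcd : c < d) {w : E}
    (hsl : ∀ q ∈ Icc c d, slice S q = ((q - c) • w) +ᵥ K) {q : ℝ} {y : E} (hy : (q, y) ∈ S) :
    y - (q - c) • w ∈ K := by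
  have hiff : ∀ q ∈ Icc c d, ∀ y, (q, y) ∈ S ↔ y - (q - c) • w ∈ K := by
    intro q hq y
    rw [← mem_slice, hsl q hq, mem_vadd_set_iff_neg_vadd_mem, vadd_eq_add, neg_add_eq_sub]
  rcases lt_or_ge q c with hqc | hqc
  · have hdq : 0 < d - q := by linarith
    set θ := (d - c) / (d - q) with hθ
    have hθ0 : 0 < θ := div_pos (by linarith) hdq
    have hθ1 : θ ≤ 1 := (div_le_one hdq).2 (by linarith)
    have hθq : θ * (d - q) = d - c := div_mul_cancel₀ _ hdq.ne'
    refine mem_of_forall_smul_add_mem hK hKne hθ0 hθ1 fun k hk => ?_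
    have h1 : (d, k + (d - c) • w) ∈ S := (hiff d ⟨hcd.le, le_rfl⟩ _).2 (by simpa using hk)
    have h2 := hS hy h1 hθ0.le (sub_nonneg.2 hθ1) (by ring)
    have h3 : θ • (q, y) + (1 - θ) • (d, k + (d - c) • w) =
        (c, θ • y + (1 - θ) • (k + (d - c) • w)) := by
      ext
      · simp only [Prod.smul_mk, Prod.mk_add_mk, smul_eq_mul]; linear_combination -hθq
      · rfl
    rw [h3, hiff c ⟨le_rfl, hcd.le⟩] at h2
    convert h2 using 1
    have h4 : (1 - θ) * (d - c) = -θ * (q - c) := by linear_combination -hθq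
    rw [sub_self, zero_smul, sub_zero, smul_add (1 - θ) k, smul_smul, h4]
    module
  rcases lt_or_ge d q with hqd | hqd
  · have hcq : 0 < q - c := by linarith
    set θ := (d - c) / (q - c) with hθ
    have hθ0 : 0 < θ := div_pos (by linarith) hcq
    have hθ1 : θ ≤ 1 := (div_le_one hcq).2 (by linarith)
    have hθq : θ * (q - c) = d - c := div_mul_cancel₀ _ hcq.ne'
    refine mem_of_forall_smul_add_mem hK hKne hθ0 hθ1 fun k hk => ?_
    have h1 : (c, k) ∈ S := (hiff c ⟨le_rfl, hcd.le⟩ _).2 (by simpa using hk)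
    have h2 := hS hy h1 hθ0.le (sub_nonneg.2 hθ1) (by ring)
    have h3 : θ • (q, y) + (1 - θ) • (c, k) = (d, θ • y + (1 - θ) • k) := by
      ext
      · simp only [Prod.smul_mk, Prod.mk_add_mk, smul_eq_mul]; linear_combination hθq
      · rfl
    rw [h3, hiff d ⟨hcd.le, le_rfl⟩, ← hθq] at h2
    convert h2 using 1
    module
  · exact (hiff q ⟨hqc, hqd⟩ y).1 hy

end Translates

section Structure

variable {E : Type*} [NormedAddCommGroup E] [NormedSpace ℝ E] [MeasurableSpace E]
  [FiniteDimensional ℝ E] [BorelSpace E] {μ : Measure E} [μ.IsAddHaarMeasure]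
  {A B C : Set (ℝ × E)} {α β : ℝ}

namespace SliceEquality

theorem exists_shift_right (h : SliceEquality μ A B C α β) (hE : 0 < finrank ℝ E) {b₁ d₁ : ℝ}
    (hb₁ : IsGreatest {p | 1 ≤ sliceRoot μ A p} b₁)
    (hd₁ : IsGreatest {p | 1 ≤ sliceRoot μ B p} d₁) :
    ∃ x : E, ∀ z : ℝ × E, b₁ ≤ z.1 → (z ∈ A ↔ z + (d₁ - b₁, x) ∈ B) := by
  have hleast : ∀ {S : Set (ℝ × E)} {b : ℝ}, IsGreatest {p | 1 ≤ sliceRoot μ S p} b →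
      IsLeast {p | 1 ≤ sliceRoot μ (BonnesenSections.reflect S) p} (-b) := by
    intro S b hb
    refine ⟨?_, fun p hp => ?_⟩
    · have := hb.1
      simpa [sliceRoot, slice_reflect] using this
    · have : -p ≤ b := hb.2 hp
      linarith
  obtain ⟨x, hx⟩ := h.reflect.exists_shift_left hE (hleast hb₁) (hleast hd₁)
  refine ⟨x, fun z hz => ?_⟩
  have := hx (-z.1, z.2) (neg_le_neg hz)
  have e : (z.1 + (d₁ - b₁), z.2 + x) = z + (d₁ - b₁, x) := rfl
  have e' : -(-z.1 + (-d₁ - -b₁)) = z.1 + (d₁ - b₁) := by ring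
  simpa only [BonnesenSections.reflect, mem_preimage, neg_neg, Prod.mk_add_mk, e', e] using this

/-- The slices over the plateaus of two bodies with equality are parallel cylinders. -/
theorem exists_slice_eq_vadd (h : SliceEquality μ A B C α β) (hE : 0 < finrank ℝ E)
    {a₁ b₁ c₁ d₁ : ℝ} (hab : a₁ ≤ b₁) (hcd : c₁ ≤ d₁)
    (hA : {p | 1 ≤ sliceRoot μ A p} = Icc a₁ b₁) (hB : {p | 1 ≤ sliceRoot μ B p} = Icc c₁ d₁)
    (hlen : b₁ - a₁ ≤ d₁ - c₁) {x : E} (hx : slice B c₁ = x +ᵥ slice A a₁) :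
    ∃ w : E, (∀ p ∈ Icc a₁ b₁, slice A p = ((p - a₁) • w) +ᵥ slice A a₁) ∧
      ∀ q ∈ Icc c₁ d₁, slice B q = (x + (q - c₁) • w) +ᵥ slice A a₁ := by
  set K := slice A a₁ with hKdef
  have hα := h.left_pos
  have hβ := h.right_pos
  have hαβ := h.add_eq_one
  have hK : IsCompact K := isCompact_slice h.isCompact_left a₁
  have hKc : Convex ℝ K := convex_slice h.convex_left a₁
  have hA1 : ∀ p ∈ Icc a₁ b₁, sliceRoot μ A p = 1 := fun p hp =>
    (h.isGreatest_left.2 ⟨p, rfl⟩).antisymm (hA.ge hp)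
  have hB1 : ∀ q ∈ Icc c₁ d₁, sliceRoot μ B q = 1 := fun q hq =>
    (h.isGreatest_right.2 ⟨q, rfl⟩).antisymm (hB.ge hq)
  have ha₁ : a₁ ∈ Icc a₁ b₁ := left_mem_Icc.2 hab
  have hc₁ : c₁ ∈ Icc c₁ d₁ := left_mem_Icc.2 hcd
  have hKne : K.Nonempty := slice_nonempty_of_sliceRoot_pos (μ := μ) hE
    (by rw [hA1 a₁ ha₁]; exact one_pos)
  have hinj : ∀ {a b : E}, a +ᵥ K ⊆ b +ᵥ K → a = b := fun hab => eq_of_vadd_subset_vadd hK hKne hab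
  have hpair : ∀ p ∈ Icc a₁ b₁, ∀ q ∈ Icc c₁ d₁, (∃ z : E, slice B q = z +ᵥ slice A p) ∧
      α • slice A p + β • slice B q = slice C (α * p + β * q) := fun p hp q hq =>
    h.slice_eq hE (by rw [hA1 p hp]; exact one_pos) (by rw [hA1 p hp, hB1 q hq])
      (by rw [hA1 p hp]; exact h.sliceRoot_le_one _)
  have hexB : ∀ q, ∃ z : E, q ∈ Icc c₁ d₁ → slice B q = z +ᵥ K := by
    intro q
    by_cases hq : q ∈ Icc c₁ d₁
    · obtain ⟨z, hz⟩ := (hpair a₁ ha₁ q hq).1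
      exact ⟨z, fun _ => hz⟩
    · exact ⟨0, fun h => absurd h hq⟩
  have hexA : ∀ p, ∃ z : E, p ∈ Icc a₁ b₁ → slice A p = z +ᵥ K := by
    intro p
    by_cases hp : p ∈ Icc a₁ b₁
    · obtain ⟨z, hz⟩ := (hpair p hp c₁ hc₁).1
      refine ⟨-z + x, fun _ => ?_⟩
      rw [add_vadd, ← hx, hz, neg_vadd_vadd]
    · exact ⟨0, fun h => absurd h hp⟩
  choose y hy using hexB
  choose v hv using hexA
  have hyc : y c₁ = x := hinj (by rw [← hy c₁ hc₁, hx])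
  have hva : v a₁ = 0 := hinj (by rw [← hv a₁ ha₁, zero_vadd])
  have hva' : ∀ p ∈ Icc a₁ b₁, ∀ s ∈ Icc (0 : ℝ) 1, v (s * p + (1 - s) * a₁) = s • v p := by
    intro p hp s hs
    have hmem : s * p + (1 - s) * a₁ ∈ Icc a₁ b₁ :=
      convex_Icc a₁ b₁ hp ha₁ hs.1 (sub_nonneg.2 hs.2) (by ring)
    have h1 := smul_slice_add_subset h.convex_left p a₁ hs.1 (sub_nonneg.2 hs.2) (by ring)
    rw [hv p hp, hv a₁ ha₁, smul_vadd_add_smul_vadd hKc hs.1 (sub_nonneg.2 hs.2) (by ring),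
      hv _ hmem] at h1
    have := hinj h1
    rw [hva, smul_zero, add_zero] at this
    exact this.symm
  have hyc' : ∀ q ∈ Icc c₁ d₁, ∀ s ∈ Icc (0 : ℝ) 1,
      y (s * q + (1 - s) * c₁) = s • y q + (1 - s) • x := by
    intro q hq s hs
    have hmem : s * q + (1 - s) * c₁ ∈ Icc c₁ d₁ :=
      convex_Icc c₁ d₁ hq hc₁ hs.1 (sub_nonneg.2 hs.2) (by ring)
    have h1 := smul_slice_add_subset h.convex_right q c₁ hs.1 (sub_nonneg.2 hs.2) (by ring)
    rw [hy q hq, hy c₁ hc₁, smul_vadd_add_smul_vadd hKc hs.1 (sub_nonneg.2 hs.2) (by ring),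
      hy _ hmem] at h1
    have := hinj h1
    rw [hyc] at this
    exact this.symm
  set w := (d₁ - c₁)⁻¹ • (y d₁ - x) with hw
  have hyq : ∀ q ∈ Icc c₁ d₁, y q = x + (q - c₁) • w := by
    intro q hq
    rcases hcd.eq_or_lt with heq | hlt
    · obtain rfl : q = c₁ := le_antisymm (heq ▸ hq.2) hq.1
      simp [hyc]
    have hdc : d₁ - c₁ ≠ 0 := by linarith
    have h1 := hyc' d₁ (right_mem_Icc.2 hcd) ((q - c₁) / (d₁ - c₁))
      ⟨div_nonneg (by linarith [hq.1]) (by linarith), (div_le_one (by linarith)).2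
        (by linarith [hq.2])⟩
    have h2 : (q - c₁) / (d₁ - c₁) * d₁ + (1 - (q - c₁) / (d₁ - c₁)) * c₁ = q := by
      field_simp; ring
    rw [h2] at h1
    rw [h1, hw, smul_smul, ← div_eq_mul_inv]
    module
  refine ⟨w, fun p hp => ?_, fun q hq => by rw [hy q hq, hyq q hq]⟩
  rw [hv p hp]
  congr 1
  have hα1 : α ∈ Icc (0 : ℝ) 1 := ⟨hα.le, by linarith⟩
  set δ := p - a₁ with hδ
  have hp' : α * p + (1 - α) * a₁ ∈ Icc a₁ b₁ :=
    convex_Icc a₁ b₁ hp ha₁ hα.le (by linarith) (by ring)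
  have hδ0 : 0 ≤ δ := sub_nonneg.2 hp.1
  have hq' : c₁ + α * δ ∈ Icc c₁ d₁ := by
    refine ⟨by nlinarith, ?_⟩
    have : α * δ ≤ δ := by nlinarith [hα1.2]
    linarith [hp.2]
  have h1 := (hpair p hp c₁ hc₁).2
  have h2 := (hpair _ hp' _ hq').2
  have e : α * (α * p + (1 - α) * a₁) + β * (c₁ + α * δ) = α * p + β * c₁ := by
    obtain rfl : β = 1 - α := by linarith
    rw [hδ]; ring
  rw [e, ← h1, hv _ hp', hy _ hq', hv p hp, hy c₁ hc₁,
    smul_vadd_add_smul_vadd hKc hα.le hβ.le hαβ, smul_vadd_add_smul_vadd hKc hα.le hβ.le hαβ] at h2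
  have h3 := hinj h2.le
  rw [hva' p hp α hα1, hyq _ hq', hyc, add_sub_cancel_left] at h3
  have h4 : (α * β) • (v p - δ • w) = 0 := by
    obtain rfl : β = 1 - α := by linarith
    have h5 : α • v p + (1 - α) • x - (α • α • v p + (1 - α) • (x + (α * δ) • w)) = 0 := by
      rw [h3, sub_self]
    rw [← h5]
    module
  rcases smul_eq_zero.1 h4 with h5 | h5
  · exact absurd h5 (by positivity)
  · exact sub_eq_zero.1 h5

end SliceEquality

end Structure

section StructureTheorem

variable {E : Type*} [NormedAddCommGroup E] [NormedSpace ℝ E] [MeasurableSpace E]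
  [FiniteDimensional ℝ E] [BorelSpace E] {μ : Measure E} [μ.IsAddHaarMeasure]
  {A B C : Set (ℝ × E)} {α β : ℝ}

/-- `B` is a translate of `A`, or it is obtained by stretching `A` along the direction `(1, w)` and
`A` projects along this direction onto one of its horizontal slices. -/
def IsTranslateOrStretch (A B : Set (ℝ × E)) : Prop :=
  (∃ ξ : ℝ × E, B = ξ +ᵥ A) ∨ ∃ (w : E) (c l : ℝ) (ξ : ℝ × E), 0 ≤ l ∧
    (∀ z ∈ A, z + (c - z.1) • ((1, w) : ℝ × E) ∈ A) ∧
      B = A + segment ℝ ξ (ξ + l • ((1, w) : ℝ × E))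

namespace SliceEquality

theorem isTranslateOrStretch_of_le (h : SliceEquality μ A B C α β) (hE : 0 < finrank ℝ E)
    {a₁ b₁ c₁ d₁ : ℝ} (hab : a₁ ≤ b₁) (hcd : c₁ ≤ d₁)
    (hA : {p | 1 ≤ sliceRoot μ A p} = Icc a₁ b₁) (hB : {p | 1 ≤ sliceRoot μ B p} = Icc c₁ d₁)
    (hlen : b₁ - a₁ ≤ d₁ - c₁) : IsTranslateOrStretch A B := by
  obtain ⟨x, hx⟩ := h.exists_shift_left hE (hA ▸ isLeast_Icc hab) (hB ▸ isLeast_Icc hcd)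
  obtain ⟨y, hy⟩ := h.exists_shift_right hE (hA ▸ isGreatest_Icc hab) (hB ▸ isGreatest_Icc hcd)
  have hshift : ∀ {p k : ℝ} {x : E}, (∀ m, (p, m) ∈ A ↔ (p, m) + (k, x) ∈ B) →
      slice B (p + k) = x +ᵥ slice A p := by
    intro p k x hp
    ext m
    rw [mem_vadd_set_iff_neg_vadd_mem, mem_slice, mem_slice, hp, vadd_eq_add]
    simp
  have hslB : slice B c₁ = x +ᵥ slice A a₁ := by
    rw [← hshift fun m => hx (a₁, m) le_rfl, add_sub_cancel]
  obtain ⟨w, hwA, hwB⟩ := h.exists_slice_eq_vadd hE hab hcd hA hB hlen hslB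
  set K := slice A a₁ with hKdef
  have hK : IsCompact K := isCompact_slice h.isCompact_left a₁
  have hKne : K.Nonempty := by
    have h1 : 1 ≤ sliceRoot μ A a₁ := hA.ge (left_mem_Icc.2 hab)
    exact slice_nonempty_of_sliceRoot_pos hE (one_pos.trans_le h1)
  set l := (d₁ - c₁) - (b₁ - a₁) with hl
  have hl0 : 0 ≤ l := sub_nonneg.2 hlen
  have hyx : y = x + l • w := by
    have h1 : slice B d₁ = y +ᵥ slice A b₁ := by
      rw [← hshift fun m => hy (b₁, m) le_rfl, add_sub_cancel]
    rw [hwA b₁ (right_mem_Icc.2 hab), hwB d₁ (right_mem_Icc.2 hcd), vadd_vadd] at h1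
    have h2 := eq_of_vadd_subset_vadd hK hKne h1.le
    rw [hl, sub_smul _ (b₁ - a₁), ← add_sub_assoc, h2, add_sub_cancel_right]
  set F : ℝ → E → Prop := fun p m => (p, m + (p - a₁) • w) ∈ A
  have hF : ∀ p m, F p m ↔ (p, m + (p - a₁) • w) ∈ A := fun _ _ => Iff.rfl
  set G : ℝ → E → Prop := fun p m => (p + (c₁ - a₁), m + (p - a₁) • w + x) ∈ B
  have hG : ∀ p m, G p m ↔ (p + (c₁ - a₁), m + (p - a₁) • w + x) ∈ B := fun _ _ => Iff.rfl
  have hFK : ∀ p ∈ Icc a₁ b₁, ∀ m, F p m ↔ m ∈ K := by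
    intro p hp m
    rw [hF, ← mem_slice, hwA p hp, mem_vadd_set_iff_neg_vadd_mem, vadd_eq_add, neg_add_eq_sub,
      add_sub_cancel_right]
  have hGK : ∀ p ∈ Icc a₁ (b₁ + l), ∀ m, G p m ↔ m ∈ K := by
    intro p hp m
    rw [hG, ← mem_slice, hwB _ ⟨by linarith [hp.1], by linarith [hp.2]⟩,
      mem_vadd_set_iff_neg_vadd_mem, vadd_eq_add, neg_add_eq_sub]
    convert Iff.rfl using 2
    module
  have hleft : ∀ p ≤ a₁, ∀ m, F p m ↔ G p m := fun p hp m => hx (p, _) hp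
  have hright : ∀ p, b₁ ≤ p → ∀ m, F p m ↔ G (p + l) m := by
    intro p hp m
    rw [hF, hy (p, _) hp, hG, Prod.mk_add_mk, hyx]
    have e1 : p + (d₁ - b₁) = p + l + (c₁ - a₁) := by rw [hl]; ring
    have e2 : m + (p - a₁) • w + (x + l • w) = m + (p + l - a₁) • w + x := by module
    rw [e1, e2]
  have hAF : ∀ z : ℝ × E, z ∈ A ↔ F z.1 (z.2 - (z.1 - a₁) • w) := by
    intro z
    rw [hF, sub_add_cancel]
  have hBG : ∀ z : ℝ × E, z ∈ B ↔ G (z.1 - (c₁ - a₁)) (z.2 - x - (z.1 - (c₁ - a₁) - a₁) • w) := by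
    intro z
    rw [hG, sub_add_cancel, sub_add_cancel, sub_add_cancel]
  rcases hl0.eq_or_lt with hl0' | hlpos
  · left
    refine ⟨(c₁ - a₁, x), ?_⟩
    have hFG : ∀ p m, F p m ↔ G p m := by
      intro p m
      rcases le_or_gt p a₁ with hp | hp
      · exact hleft p hp m
      rcases le_or_gt b₁ p with hp' | hp'
      · have := hright p hp' m
        rwa [← hl0', add_zero] at this
      · rw [hFK p ⟨hp.le, hp'.le⟩, hGK p ⟨hp.le, by linarith⟩]
    ext z
    rw [mem_vadd_set_iff_neg_vadd_mem, hAF, hFG, hBG, vadd_eq_add, neg_add_eq_sub, Prod.fst_sub,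
      Prod.snd_sub]
  right
  have hGmem : ∀ p m, G p m → m ∈ K := by
    intro p m hp
    have := mem_of_slice_eq_vadd (K := x +ᵥ K) (hK.isClosed.vadd x) hKne.vadd_set h.convex_right
      (c := c₁) (d := d₁) (w := w) (by linarith) (fun q hq => by
        rw [hwB q hq, vadd_vadd, add_comm]) hp
    rw [mem_vadd_set_iff_neg_vadd_mem, vadd_eq_add] at this
    convert this using 1
    module
  have hFmem : ∀ p m, F p m → m ∈ K := by
    intro p m hp
    rcases le_or_gt p a₁ with hp' | hp'
    · exact hGmem p m ((hleft p hp' m).1 hp)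
    rcases le_or_gt b₁ p with hp'' | hp''
    · exact hGmem _ m ((hright p hp'' m).1 hp)
    · exact (hFK p ⟨hp'.le, hp''.le⟩ m).1 hp
  have hGconv : ∀ m p q r, G p m → G q m → p ≤ r → r ≤ q → G r m := by
    intro m p q r hp hq hpr hrq
    rcases hpr.eq_or_lt with rfl | hpr
    · exact hp
    have hqp : 0 < q - p := by linarith
    have h1 := h.convex_right hp hq (a := (q - r) / (q - p)) (b := (r - p) / (q - p))
      (div_nonneg (by linarith) hqp.le) (div_nonneg (by linarith) hqp.le)
      (by field_simp; ring)
    have e : (q - r) / (q - p) = 1 - (r - p) / (q - p) := by field_simp; ring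
    have e' : (r - p) / (q - p) * (q - p) = r - p := div_mul_cancel₀ _ hqp.ne'
    rw [e] at h1
    generalize (r - p) / (q - p) = s at h1 e'
    rw [hG]
    convert h1 using 1
    obtain rfl : r = p + s * (q - p) := by linarith
    ext
    · simp only [Prod.smul_mk, Prod.mk_add_mk, smul_eq_mul]; ring
    · simp only [Prod.smul_mk, Prod.mk_add_mk]; module
  refine ⟨w, a₁, l, (c₁ - a₁, x), hl0, fun z hz => ?_, ?_⟩
  · have h1 := (hFK a₁ (left_mem_Icc.2 hab) _).2 (hFmem _ _ ((hAF z).1 hz))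
    rw [hF] at h1
    convert h1 using 1
    ext
    · simp
    · simp only [Prod.snd_add, Prod.smul_snd]; module
  ext z
  have hseg : ∀ r ∈ Icc 0 l, ((c₁ - a₁, x) : ℝ × E) + r • ((1, w) : ℝ × E) ∈
      segment ℝ ((c₁ - a₁, x) : ℝ × E) ((c₁ - a₁, x) + l • ((1, w) : ℝ × E)) := by
    intro r hr
    rw [segment_eq_image']
    refine ⟨r / l, ⟨div_nonneg hr.1 hl0, (div_le_one hlpos).2 hr.2⟩, ?_⟩
    simp only [add_sub_cancel_left, smul_smul, div_mul_cancel₀ _ hlpos.ne']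
  constructor
  · intro hz
    have hz' := (hBG z).1 hz
    set t := z.1 - (c₁ - a₁) with ht
    set m := z.2 - x - (t - a₁) • w with hm
    obtain ⟨r, hr, hFr⟩ : ∃ r ∈ Icc 0 l, F (t - r) m := by
      rcases le_or_gt t a₁ with h1 | h1
      · exact ⟨0, ⟨le_rfl, hl0⟩, by rwa [sub_zero, hleft t h1]⟩
      rcases le_or_gt (b₁ + l) t with h2 | h2
      · exact ⟨l, ⟨hl0, le_rfl⟩, by rwa [hright _ (by linarith), sub_add_cancel]⟩
      have hmK := hGmem _ _ hz'
      rcases le_or_gt t b₁ with h3 | h3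
      · exact ⟨0, ⟨le_rfl, hl0⟩, (hFK _ ⟨by linarith, by linarith⟩ m).2 hmK⟩
      · exact ⟨t - b₁, ⟨by linarith, by linarith⟩, (hFK _ ⟨by linarith, by linarith⟩ m).2 hmK⟩
    refine ⟨_, hFr, _, hseg r hr, ?_⟩
    ext
    · simp [ht]
    · simp only [Prod.smul_mk, Prod.mk_add_mk, hm]; module
  · rintro ⟨z', hz', ζ, hζ, rfl⟩
    rw [segment_eq_image'] at hζ
    obtain ⟨s, hs, rfl⟩ := hζ
    simp only [add_sub_cancel_left, smul_smul]
    set r := s * l with hr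
    have hr0 : 0 ≤ r := mul_nonneg hs.1 hl0
    have hrl : r ≤ l := mul_le_of_le_one_left hl0 hs.2
    have hFz := (hAF z').1 hz'
    set p := z'.1 with hp
    set m := z'.2 - (p - a₁) • w with hm
    have hmK := hFmem _ _ hFz
    have hGr : G (p + r) m := by
      rcases le_or_gt p a₁ with h1 | h1
      · exact hGconv m p (b₁ + l) _ ((hleft p h1 m).1 hFz)
          ((hGK _ ⟨by linarith, le_rfl⟩ m).2 hmK) (by linarith) (by linarith)
      rcases le_or_gt b₁ p with h2 | h2
      · exact hGconv m a₁ (p + l) _ ((hGK _ ⟨le_rfl, by linarith⟩ m).2 hmK)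
          ((hright p h2 m).1 hFz) (by linarith) (by linarith)
      · exact (hGK _ ⟨by linarith, by linarith⟩ m).2 hmK
    rw [hG] at hGr
    convert hGr using 1
    ext
    · simp only [Prod.smul_mk, Prod.mk_add_mk, Prod.fst_add, smul_eq_mul]; rw [← hp]; ring
    · simp only [Prod.smul_mk, Prod.snd_add, hm]; module

theorem isTranslateOrStretch (h : SliceEquality μ A B C α β) (hE : 0 < finrank ℝ E) :
    IsTranslateOrStretch A B ∨ IsTranslateOrStretch B A := by
  obtain ⟨⟨p, hp⟩, -⟩ := h.isGreatest_left
  obtain ⟨⟨q, hq⟩, -⟩ := h.isGreatest_right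
  obtain ⟨a₁, b₁, hab, hA⟩ := superlevel_sliceRoot_eq_Icc hE h.isCompact_left h.convex_left
    one_pos ⟨p, hp.ge⟩
  obtain ⟨c₁, d₁, hcd, hB⟩ := superlevel_sliceRoot_eq_Icc hE h.isCompact_right h.convex_right
    one_pos ⟨q, hq.ge⟩
  rcases le_total (b₁ - a₁) (d₁ - c₁) with hlen | hlen
  · exact Or.inl (h.isTranslateOrStretch_of_le hE hab hcd hA hB hlen)
  · exact Or.inr (h.symm.isTranslateOrStretch_of_le hE hcd hab hB hA hlen)

end SliceEquality

end StructureTheorem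

/-! ### Coordinates adapted to a hyperplane and a transversal direction -/

section Coordinates

variable {d : ℕ} {u e : EuclideanSpace ℝ (Fin d)}

/-- The coordinates `(p, y) ↦ p • e + y` on `ℝ × u^⊥`, where `⟪e, u⟫ = 1`. -/
noncomputable def coordinates (he : ⟪e, u⟫ = 1) :
    (ℝ × (ℝ ∙ u)ᗮ) ≃L[ℝ] EuclideanSpace ℝ (Fin d) :=
  LinearEquiv.toContinuousLinearEquiv
    { toFun := fun z => z.1 • e + z.2
      map_add' := fun z z' => by simp only [Prod.fst_add, Prod.snd_add, Submodule.coe_add]; module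
      map_smul' := fun t z => by
        simp only [Prod.smul_fst, Prod.smul_snd, Submodule.coe_smul, RingHom.id_apply, smul_eq_mul]
        module
      invFun := fun x => (⟪x, u⟫, ⟨x - ⟪x, u⟫ • e, by
        rw [Submodule.mem_orthogonal_singleton_iff_inner_left, inner_sub_left, inner_smul_left, he]
        simp⟩)
      left_inv := fun z => by
        have h0 : ⟪(z.2 : EuclideanSpace ℝ (Fin d)), u⟫ = 0 :=
          Submodule.mem_orthogonal_singleton_iff_inner_left.1 z.2.2
        have h1 : ⟪z.1 • e + z.2, u⟫ = z.1 := by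
          rw [inner_add_left, inner_smul_left, he, h0]
          simp
        ext
        · exact h1
        · simp [h1]
      right_inv := fun x => by simp }

variable (he : ⟪e, u⟫ = 1)

theorem coordinates_apply (z : ℝ × (ℝ ∙ u)ᗮ) : coordinates he z = z.1 • e + z.2 := rfl

theorem inner_coordinates (z : ℝ × (ℝ ∙ u)ᗮ) : ⟪coordinates he z, u⟫ = z.1 :=
  congrArg Prod.fst ((coordinates he).symm_apply_apply z)

theorem coordinates_symm_fst (x : EuclideanSpace ℝ (Fin d)) :
    ((coordinates he).symm x).1 = ⟪x, u⟫ := rfl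

theorem finrank_orthogonal_add_one (he : ⟪e, u⟫ = 1) : finrank ℝ (ℝ ∙ u)ᗮ + 1 = d := by
  have hu : u ≠ 0 := fun h => by simp [h] at he
  have h := (ℝ ∙ u).finrank_add_finrank_orthogonal
  rw [finrank_span_singleton hu,
    finrank_euclideanSpace_fin] at h
  omega

/-- The Hausdorff measure on the hyperplane `u^⊥` whose dimension is that of `u^⊥`. -/
noncomputable def hyperplaneMeasure (u : EuclideanSpace ℝ (Fin d)) : Measure (ℝ ∙ u)ᗮ :=
  μH[finrank ℝ (ℝ ∙ u)ᗮ]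

instance : (hyperplaneMeasure u).IsAddHaarMeasure :=
  isAddHaarMeasure_hausdorffMeasure

theorem sectionVol_eq_slice (S : Set (EuclideanSpace ℝ (Fin d))) (p : ℝ) :
    sectionVol d S u p = (hyperplaneMeasure u).real (slice (coordinates he ⁻¹' S) p) := by
  have hset : S ∩ {x | ⟪x, u⟫ = p} =
      (fun y : (ℝ ∙ u)ᗮ => p • e + (y : EuclideanSpace ℝ (Fin d))) ''
        slice (coordinates he ⁻¹' S) p := by
    ext x
    constructor
    · rintro ⟨hx, hxp⟩
      have hx1 : coordinates he (p, ((coordinates he).symm x).2) = x := by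
        rw [← show _ = p from hxp, ← coordinates_symm_fst he]
        exact (coordinates he).apply_symm_apply x
      refine ⟨((coordinates he).symm x).2, ?_, hx1⟩
      rw [mem_slice, mem_preimage, hx1]
      exact hx
    · rintro ⟨y, hy, rfl⟩
      exact ⟨hy, inner_coordinates he (p, y)⟩
  have hiso : Isometry fun y : (ℝ ∙ u)ᗮ => p • e + (y : EuclideanSpace ℝ (Fin d)) :=
    Isometry.of_dist_eq fun y y' => by simp [dist_eq_norm]
  have hd : (d : ℝ) - 1 = finrank ℝ (ℝ ∙ u)ᗮ := by
    rw [sub_eq_iff_eq_add]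
    exact_mod_cast (finrank_orthogonal_add_one he).symm
  rw [sectionVol, hset, hd, hiso.hausdorffMeasure_image (Or.inl (Nat.cast_nonneg _))]
  rfl

theorem exists_volume_eq_coordinates : ∃ κ : ℝ, 0 < κ ∧ ∀ S : Set (EuclideanSpace ℝ (Fin d)),
    (volume S).toReal =
      κ * ((volume : Measure ℝ).prod (hyperplaneMeasure u)).real (coordinates he ⁻¹' S) := by
  set Λ := coordinates he
  have hmap : (((volume : Measure ℝ).prod (hyperplaneMeasure u)).map Λ).IsAddHaarMeasure :=
    Λ.isAddHaarMeasure_map _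
  have hc := Measure.isAddLeftInvariant_eq_smul (volume : Measure (EuclideanSpace ℝ (Fin d)))
    (((volume : Measure ℝ).prod (hyperplaneMeasure u)).map Λ)
  refine ⟨_, NNReal.coe_pos.2 (Measure.addHaarScalarFactor_pos_of_isAddHaarMeasure
    (volume : Measure (EuclideanSpace ℝ (Fin d)))
    (((volume : Measure ℝ).prod (hyperplaneMeasure u)).map Λ)), fun S => ?_⟩
  have h1 : (((volume : Measure ℝ).prod (hyperplaneMeasure u)).map Λ) S =
      ((volume : Measure ℝ).prod (hyperplaneMeasure u)) (Λ ⁻¹' S) :=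
    Λ.toHomeomorph.toMeasurableEquiv.map_apply S
  conv_lhs => rw [hc, Measure.smul_apply, h1]
  rw [ENNReal.smul_def, smul_eq_mul, ENNReal.toReal_mul]
  rfl

theorem preimage_coordinates_eq (S : Set (EuclideanSpace ℝ (Fin d))) :
    coordinates he ⁻¹' S = (coordinates he).symm '' S :=
  ((coordinates he).image_symm_eq_preimage S).symm

theorem preimage_coordinates_add (S T : Set (EuclideanSpace ℝ (Fin d))) :
    coordinates he ⁻¹' (S + T) = coordinates he ⁻¹' S + coordinates he ⁻¹' T := by
  simp only [preimage_coordinates_eq]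
  exact image_add (coordinates he).symm

theorem preimage_coordinates_smul (t : ℝ) (S : Set (EuclideanSpace ℝ (Fin d))) :
    coordinates he ⁻¹' (t • S) = t • coordinates he ⁻¹' S := by
  simp only [preimage_coordinates_eq]
  exact image_smul_set (coordinates he).symm t S

theorem isCompact_preimage_coordinates {S : Set (EuclideanSpace ℝ (Fin d))} (hS : IsCompact S) :
    IsCompact (coordinates he ⁻¹' S) :=
  (coordinates he).toHomeomorph.isCompact_preimage.2 hS

theorem convex_preimage_coordinates {S : Set (EuclideanSpace ℝ (Fin d))} (hS : Convex ℝ S) :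
    Convex ℝ (coordinates he ⁻¹' S) :=
  hS.linear_preimage (coordinates he).toLinearEquiv.toLinearMap

end Coordinates

theorem exists_sliceRoot_pos_of_interior {E : Type*} [NormedAddCommGroup E] [NormedSpace ℝ E]
    [MeasurableSpace E] {μ : Measure E} [μ.IsOpenPosMeasure] [IsFiniteMeasureOnCompacts μ]
    {S : Set (ℝ × E)} (hS : IsCompact S) (hi : (interior S).Nonempty) :
    ∃ p q, p ≠ q ∧ 0 < sliceRoot μ S p ∧ 0 < sliceRoot μ S q := by
  obtain ⟨⟨p, y⟩, hz⟩ := hi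
  have hpos : ∀ r, (r, y) ∈ interior S → 0 < sliceRoot μ S r := by
    intro r hr
    have h1 : (interior (slice S r)).Nonempty := by
      refine ⟨y, mem_interior.2 ⟨Prod.mk r ⁻¹' interior S, preimage_mono interior_subset, ?_, hr⟩⟩
      exact isOpen_interior.preimage (by fun_prop)
    exact Real.rpow_pos_of_pos (ENNReal.toReal_pos
      (Measure.measure_pos_of_nonempty_interior μ h1).ne' (isCompact_slice hS r).measure_ne_top) _
  have hev : ∀ᶠ r in 𝓝 p, (r, y) ∈ interior S := by
    have hc : Continuous fun r : ℝ => (r, y) := by fun_prop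
    exact hc.continuousAt.eventually (isOpen_interior.mem_nhds hz)
  obtain ⟨q, hqp, hq⟩ := ((frequently_gt_nhds p).and_eventually hev).exists
  exact ⟨p, q, (ne_of_gt hqp).symm, hpos p hz, hpos q hq⟩

/-! ### Bodies with equality -/

section Forward

variable {d : ℕ} {u : EuclideanSpace ℝ (Fin d)} {A B : Set (EuclideanSpace ℝ (Fin d))}

theorem stretchOf_refl (A : Set (EuclideanSpace ℝ (Fin d))) (v : EuclideanSpace ℝ (Fin d)) :
    StretchOf A A v :=
  ⟨0, le_rfl, 0, by simp⟩

theorem exists_stretchOf_of_translateOrStretch {e : EuclideanSpace ℝ (Fin d)} (he : ⟪e, u⟫ = 1)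
    (h : IsTranslateOrStretch (coordinates he ⁻¹' A) (coordinates he ⁻¹' B)) :
    (∃ x : EuclideanSpace ℝ (Fin d), B = x +ᵥ A) ∨
      ∃ (v : EuclideanSpace ℝ (Fin d)) (c : ℝ), ‖v‖ = 1 ∧
      (fun x => x - ⟪x, v⟫ • v) '' A =
        (fun x => x - ⟪x, v⟫ • v) '' (A ∩ {x | ⟪x, u⟫ = c}) ∧ StretchOf B A v := by
  set Λ := coordinates he with hΛ
  have himage : ∀ S : Set (EuclideanSpace ℝ (Fin d)), S = Λ '' (Λ ⁻¹' S) := fun S =>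
    (image_preimage_eq S Λ.surjective).symm
  rcases h with ⟨ξ, hξ⟩ | ⟨w, c, l, ξ, hl, hproj, hB⟩
  · left
    refine ⟨Λ ξ, ?_⟩
    rw [himage B, hξ]
    conv_rhs => rw [himage A]
    ext x
    constructor
    · rintro ⟨_, ⟨z, hz, rfl⟩, rfl⟩
      exact ⟨Λ z, mem_image_of_mem _ hz, by simp⟩
    · rintro ⟨_, ⟨z, hz, rfl⟩, rfl⟩
      exact ⟨ξ +ᵥ z, vadd_mem_vadd_set hz, by simp⟩
  right
  set f := Λ (1, w) with hf
  have hfu : ⟪f, u⟫ = 1 := inner_coordinates he (1, w)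
  have hf0 : f ≠ 0 := fun h0 => by simp [h0] at hfu
  have hfn : 0 < ‖f‖ := norm_pos_iff.2 hf0
  have hv : ‖‖f‖⁻¹ • f‖ = 1 := by
    rw [norm_smul, norm_inv, norm_norm, inv_mul_cancel₀ hfn.ne']
  have hfv : f = ‖f‖ • ‖f‖⁻¹ • f := by rw [smul_smul, mul_inv_cancel₀ hfn.ne', one_smul]
  refine ⟨‖f‖⁻¹ • f, c, hv, ?_, l * ‖f‖, by positivity, Λ ξ, ?_⟩
  · refine Subset.antisymm ?_ (image_mono inter_subset_left)
    rintro _ ⟨x, hx, rfl⟩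
    refine ⟨x + (c - ⟪x, u⟫) • f, ⟨?_, ?_⟩, ?_⟩
    · have hx' : Λ.symm x ∈ Λ ⁻¹' A := by simpa using hx
      have := hproj _ hx'
      rw [mem_preimage, map_add, map_smul, ← hf, Λ.apply_symm_apply] at this
      exact this
    · change ⟪x + (c - ⟪x, u⟫) • f, u⟫ = c
      rw [inner_add_left, real_inner_smul_left, hfu]
      ring
    · set v := ‖f‖⁻¹ • f with hvdef
      have hvv : ⟪v, v⟫ = 1 := by rw [real_inner_self_eq_norm_sq, hv, one_pow]
      simp only
      rw [hfv, inner_add_left, real_inner_smul_left, real_inner_smul_left, hvv]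
      module
  · rw [mul_smul, ← hfv]
    conv_lhs => rw [himage B, hB, image_add Λ, ← himage A]
    congr 1
    have := image_segment ℝ Λ.toLinearEquiv.toLinearMap.toAffineMap ξ (ξ + l • (1, w))
    have h2 : Λ (ξ + l • (1, w)) = Λ ξ + l • f := by rw [map_add, map_smul]
    rw [← h2]
    exact this

theorem isGreatest_sliceRoot {e : EuclideanSpace ℝ (Fin d)} (he : ⟪e, u⟫ = 1)
    (hE : 0 < finrank ℝ (ℝ ∙ u)ᗮ) {S : Set (EuclideanSpace ℝ (Fin d))}
    (hS : IsGreatest (range (sectionVol d S u)) 1) :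
    IsGreatest (range (sliceRoot (hyperplaneMeasure u) (coordinates he ⁻¹' S))) 1 := by
  have h : ∀ p, sliceRoot (hyperplaneMeasure u) (coordinates he ⁻¹' S) p =
      sectionVol d S u p ^ (finrank ℝ (ℝ ∙ u)ᗮ : ℝ)⁻¹ := fun p => by
    rw [sliceRoot, sectionVol_eq_slice he]
  obtain ⟨⟨p, hp⟩, hmax⟩ := hS
  refine ⟨⟨p, by rw [h, hp, Real.one_rpow]⟩, ?_⟩
  rintro _ ⟨q, rfl⟩
  rw [h]
  exact Real.rpow_le_one ENNReal.toReal_nonneg (hmax ⟨q, rfl⟩) (by positivity)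

theorem homothetic_or_stretchOf_of_volume_eq (hd : 2 ≤ d) (hu : ‖u‖ = 1)
    (hAc : IsCompact A) (hAcv : Convex ℝ A) (hAi : (interior A).Nonempty)
    (hBc : IsCompact B) (hBcv : Convex ℝ B)
    (hMA : IsGreatest (range (sectionVol d A u)) 1)
    (hMB : IsGreatest (range (sectionVol d B u)) 1)
    {α β : ℝ} (hα : 0 < α) (hβ : 0 < β) (hαβ : α + β = 1)
    (h : (volume (α • A + β • B)).toReal = α * (volume A).toReal + β * (volume B).toReal) :
    (∃ x : EuclideanSpace ℝ (Fin d), B = x +ᵥ A) ∨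
      ∃ (v : EuclideanSpace ℝ (Fin d)) (c : ℝ), ‖v‖ = 1 ∧
      (((fun x => x - ⟪x, v⟫ • v) '' A =
          (fun x => x - ⟪x, v⟫ • v) '' (A ∩ {x | ⟪x, u⟫ = c}) ∧ StretchOf B A v) ∨
        ((fun x => x - ⟪x, v⟫ • v) '' B =
          (fun x => x - ⟪x, v⟫ • v) '' (B ∩ {x | ⟪x, u⟫ = c}) ∧ StretchOf A B v)) := by
  have he : ⟪u, u⟫ = 1 := by rw [real_inner_self_eq_norm_sq, hu, one_pow]
  have hE : 0 < finrank ℝ (ℝ ∙ u)ᗮ := by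
    have := finrank_orthogonal_add_one he
    omega
  set μ := hyperplaneMeasure u with hμ
  set Λ := coordinates he with hΛ
  have hA := isCompact_preimage_coordinates he hAc
  have hB := isCompact_preimage_coordinates he hBc
  have hA' := convex_preimage_coordinates he hAcv
  have hB' := convex_preimage_coordinates he hBcv
  have hA2 : ∃ p q, p ≠ q ∧ 0 < sliceRoot μ (Λ ⁻¹' A) p ∧ 0 < sliceRoot μ (Λ ⁻¹' A) q := by
    refine exists_sliceRoot_pos_of_interior hA ?_
    obtain ⟨x, hx⟩ := hAi
    refine ⟨Λ.symm x, preimage_interior_subset_interior_preimage Λ.continuous ?_⟩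
    rwa [mem_preimage, Λ.apply_symm_apply]
  obtain ⟨κ, hκ, hvol⟩ := exists_volume_eq_coordinates he
  have hfin : ∀ {S : Set (ℝ × (ℝ ∙ u)ᗮ)}, IsCompact S → (volume.prod μ) S =
      ENNReal.ofReal ((volume.prod μ).real S) := fun hS =>
    (ENNReal.ofReal_toReal hS.measure_ne_top).symm
  have hle : (volume.prod μ) (α • Λ ⁻¹' A + β • Λ ⁻¹' B) ≤
      ENNReal.ofReal α * (volume.prod μ) (Λ ⁻¹' A) +
        ENNReal.ofReal β * (volume.prod μ) (Λ ⁻¹' B) := by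
    rw [hvol, hvol, hvol, preimage_coordinates_add, preimage_coordinates_smul,
      preimage_coordinates_smul] at h
    rw [hfin ((hA.smul α).add (hB.smul β)), hfin hA, hfin hB, ← ENNReal.ofReal_mul hα.le,
      ← ENNReal.ofReal_mul hβ.le, ← ENNReal.ofReal_add (by positivity) (by positivity)]
    refine ENNReal.ofReal_le_ofReal (le_of_mul_le_mul_left ?_ hκ)
    rw [h]
    exact le_of_eq (by ring)
  have hM := isGreatest_sliceRoot he hE hMA
  have hM' := isGreatest_sliceRoot he hE hMB
  have hSE : SliceEquality μ (Λ ⁻¹' A) (Λ ⁻¹' B) (α • Λ ⁻¹' A + β • Λ ⁻¹' B) α β :=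
    { left_pos := hα
      right_pos := hβ
      add_eq_one := hαβ
      isCompact_left := hA
      isCompact_right := hB
      isCompact_sum := (hA.smul α).add (hB.smul β)
      convex_left := hA'
      convex_right := hB'
      convex_sum := (hA'.smul α).add (hB'.smul β)
      isGreatest_left := hM
      isGreatest_right := hM'
      slice_subset := slice_add_subset
      exists_add_eq := fun τ' τ hτ' hτ r hr =>
        exists_add_eq_of_le_sliceRoot hE hA hB hA' hB' hM hM' hA2 hα hβ hαβ hle hτ' hτ hr }
  rcases hSE.isTranslateOrStretch hE with h1 | h1
  · rcases exists_stretchOf_of_translateOrStretch he h1 with h2 | ⟨v, c, hv, h2⟩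
    · exact Or.inl h2
    · exact Or.inr ⟨v, c, hv, Or.inl h2⟩
  · rcases exists_stretchOf_of_translateOrStretch he h1 with ⟨x, rfl⟩ | ⟨v, c, hv, h2⟩
    · exact Or.inl ⟨-x, by rw [neg_vadd_vadd]⟩
    · exact Or.inr ⟨v, c, hv, Or.inr h2⟩

end Forward

/-! ### Volumes and sections of stretched bodies -/

section Stretch

theorem measure_prod_add_Icc {E : Type*} [NormedAddCommGroup E] [NormedSpace ℝ E]
    [MeasurableSpace E] [FiniteDimensional ℝ E] [BorelSpace E] {μ : Measure E} [SFinite μ]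
    {S : Set (ℝ × E)} (hS : IsCompact S) (hSc : Convex ℝ S) {c l : ℝ} (hl : 0 ≤ l)
    (hproj : ∀ z ∈ S, (c, z.2) ∈ S) :
    (volume.prod μ) (S + Icc 0 l ×ˢ {0}) =
      (volume.prod μ) S + ENNReal.ofReal l * μ (slice S c) := by
  have hT : IsCompact (S + Icc (0 : ℝ) l ×ˢ {(0 : E)}) :=
    hS.add (isCompact_Icc.prod isCompact_singleton)
  rw [Measure.prod_apply_symm hT.measurableSet, Measure.prod_apply_symm hS.measurableSet,
    ← lintegral_indicator_const (isCompact_slice hS c).measurableSet,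
    ← lintegral_add_left (measurable_measure_prodMk_right hS.measurableSet)]
  refine lintegral_congr fun y => ?_
  have hfib : (fun p => (p, y)) ⁻¹' (S + Icc (0 : ℝ) l ×ˢ {(0 : E)}) =
      (fun p => (p, y)) ⁻¹' S + Icc 0 l := by
    ext p
    constructor
    · rintro ⟨⟨p', y'⟩, hz, ⟨t, z⟩, ⟨ht, rfl⟩, hsum⟩
      obtain ⟨rfl, rfl⟩ : p' + t = p ∧ y' = y := by simpa using hsum
      exact ⟨p', hz, t, ht, rfl⟩
    · rintro ⟨p', hz, t, ht, rfl⟩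
      exact ⟨_, hz, (t, 0), ⟨ht, rfl⟩, by simp⟩
  rw [hfib]
  by_cases hy : y ∈ slice S c
  · have hcont : Continuous fun p : ℝ => (p, y) := by fun_prop
    have hcompact : IsCompact ((fun p : ℝ => (p, y)) ⁻¹' S) :=
      (hS.image continuous_fst).of_isClosed_subset (hS.isClosed.preimage hcont)
        fun p hp => ⟨_, hp, rfl⟩
    have hconv : Convex ℝ ((fun p : ℝ => (p, y)) ⁻¹' S) := by
      intro p hp q hq s t hs ht hst
      have := hSc hp hq hs ht hst
      rw [mem_preimage]
      convert this using 1
      simp [← add_smul, hst]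
    obtain ⟨a, b, hab⟩ : ∃ a b, (fun p : ℝ => (p, y)) ⁻¹' S = Icc a b :=
      ⟨_, _, eq_Icc_of_connected_compact ⟨⟨c, hy⟩, hconv.isPreconnected⟩ hcompact⟩
    have hle : a ≤ b := by
      have : c ∈ Icc a b := hab ▸ hy
      exact this.1.trans this.2
    rw [indicator_of_mem hy, hab, Icc_add_Icc hle hl, Real.volume_Icc, Real.volume_Icc,
      ← ENNReal.ofReal_add (by linarith) hl]
    congr 1
    ring
  · have hempty : (fun p : ℝ => (p, y)) ⁻¹' S = ∅ :=
      eq_empty_of_forall_notMem fun p hp => hy (hproj _ hp)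
    rw [indicator_of_notMem hy, hempty, empty_add, measure_empty, add_zero]

variable {d : ℕ} {u e : EuclideanSpace ℝ (Fin d)} {S T : Set (EuclideanSpace ℝ (Fin d))}

theorem exists_volume_add_segment (he : ⟪e, u⟫ = 1) : ∃ κ : ℝ,
    ∀ S : Set (EuclideanSpace ℝ (Fin d)), IsCompact S → Convex ℝ S → ∀ c l : ℝ, 0 ≤ l →
      (∀ x ∈ S, x + (c - ⟪x, u⟫) • e ∈ S) →
      (volume (S + l • segment ℝ 0 e)).toReal =
        (volume S).toReal + l * (κ * sectionVol d S u c) := by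
  obtain ⟨κ, -, hκ⟩ := exists_volume_eq_coordinates he
  refine ⟨κ, fun S hS hSc c l hl hproj => ?_⟩
  have hS' := isCompact_preimage_coordinates he hS
  have hseg : coordinates he ⁻¹' (l • segment ℝ 0 e) = Icc 0 l ×ˢ {0} := by
    have h1 : ∀ t : ℝ, coordinates he (t, 0) = t • e := fun t => by simp [coordinates_apply]
    ext z
    rw [segment_eq_image', mem_preimage]
    constructor
    · rintro ⟨_, ⟨t, ht, rfl⟩, h2⟩
      simp only [sub_zero, zero_add, smul_smul] at h2
      rw [← h1] at h2
      obtain rfl := (coordinates he).injective h2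
      exact ⟨⟨mul_nonneg hl ht.1, mul_le_of_le_one_right hl ht.2⟩, rfl⟩
    · rintro ⟨ht, hz⟩
      obtain ⟨t, y⟩ := z
      obtain rfl : y = 0 := hz
      rcases hl.eq_or_lt with rfl | hl
      · obtain rfl : t = 0 := le_antisymm ht.2 ht.1
        exact ⟨0, ⟨0, by simp, by simp⟩, by simp [h1]⟩
      · refine ⟨_, ⟨t / l, ⟨div_nonneg ht.1 hl.le, (div_le_one hl).2 ht.2⟩, rfl⟩, ?_⟩
        simp only [sub_zero, zero_add, smul_smul, h1, mul_div_cancel₀ _ hl.ne']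
  have hproj' : ∀ z ∈ coordinates he ⁻¹' S, (c, z.2) ∈ coordinates he ⁻¹' S := by
    intro z hz
    have := hproj _ hz
    rw [inner_coordinates] at this
    rw [mem_preimage]
    convert this using 1
    simp only [coordinates_apply]
    module
  have hne := (hS'.measure_lt_top (μ := (volume : Measure ℝ).prod (hyperplaneMeasure u))).ne
  have hsl := (isCompact_slice hS' c).measure_ne_top (μ := hyperplaneMeasure u)
  rw [hκ, hκ, preimage_coordinates_add, hseg, Measure.real, Measure.real,
    measure_prod_add_Icc hS' (convex_preimage_coordinates he hSc) hl hproj',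
    ENNReal.toReal_add hne (ENNReal.mul_ne_top ENNReal.ofReal_ne_top hsl), ENNReal.toReal_mul,
    ENNReal.toReal_ofReal hl, sectionVol_eq_slice he, Measure.real]
  ring

theorem sectionVol_mono (he : ⟪e, u⟫ = 1) (hT : IsCompact T) {p q : ℝ}
    (h : ∀ x ∈ S, ⟪x, u⟫ = p → x + (q - p) • e ∈ T) :
    sectionVol d S u p ≤ sectionVol d T u q := by
  rw [sectionVol_eq_slice he, sectionVol_eq_slice he]
  refine measureReal_mono (fun y hy => ?_)
    (isCompact_slice (isCompact_preimage_coordinates he hT) q).measure_ne_top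
  have := h _ hy (inner_coordinates he _)
  rw [mem_slice, mem_preimage]
  convert this using 1
  simp only [coordinates_apply]
  module

theorem isGreatest_sectionVol_of_forall_mem (he : ⟪e, u⟫ = 1) (hS : IsCompact S)
    (hT : IsCompact T) (hST : S ⊆ T) {c : ℝ} (hproj : ∀ x ∈ T, x + (c - ⟪x, u⟫) • e ∈ S)
    (h : IsGreatest (range (sectionVol d T u)) 1) :
    sectionVol d S u c = 1 ∧ IsGreatest (range (sectionVol d S u)) 1 := by
  obtain ⟨⟨p, hp⟩, hmax⟩ := h
  have hle : ∀ q, sectionVol d S u q ≤ 1 := fun q =>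
    (sectionVol_mono he hT fun x hx _ => by simpa using hST hx).trans (hmax ⟨q, rfl⟩)
  have hc : sectionVol d S u c = 1 := by
    refine (hle c).antisymm ?_
    rw [← hp]
    refine sectionVol_mono he hS fun x hx hxp => ?_
    rw [← hxp]
    exact hproj x hx
  refine ⟨hc, ⟨c, hc⟩, ?_⟩
  rintro _ ⟨q, rfl⟩
  exact hle q

theorem sectionVol_vadd_smul (hd : 2 ≤ d) {r : ℝ} (hr : 0 < r) (x : EuclideanSpace ℝ (Fin d))
    (S : Set (EuclideanSpace ℝ (Fin d))) (p : ℝ) :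
    sectionVol d (x +ᵥ r • S) u (⟪x, u⟫ + r * p) = r ^ ((d : ℝ) - 1) * sectionVol d S u p := by
  have hset : (x +ᵥ r • S) ∩ {y | ⟪y, u⟫ = ⟪x, u⟫ + r * p} = x +ᵥ r • (S ∩ {y | ⟪y, u⟫ = p}) := by
    ext y
    constructor
    · rintro ⟨⟨_, ⟨z, hz, rfl⟩, rfl⟩, hy⟩
      refine ⟨_, ⟨z, ⟨hz, ?_⟩, rfl⟩, rfl⟩
      change ⟪x + r • z, u⟫ = _ at hy
      rw [inner_add_left, real_inner_smul_left] at hy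
      exact mul_left_cancel₀ hr.ne' (add_left_cancel hy)
    · rintro ⟨_, ⟨z, ⟨hz, hzp⟩, rfl⟩, rfl⟩
      refine ⟨⟨_, ⟨z, hz, rfl⟩, rfl⟩, ?_⟩
      change ⟪x + r • z, u⟫ = _
      rw [inner_add_left, real_inner_smul_left, show ⟪z, u⟫ = p from hzp]
  have hd' : (0 : ℝ) ≤ d - 1 := by
    have : (2 : ℝ) ≤ d := by exact_mod_cast hd
    linarith
  rw [sectionVol, hset, hausdorffMeasure_vadd _ (Or.inl hd'),
    Measure.hausdorffMeasure_smul₀ hd' hr.ne', ENNReal.smul_def, smul_eq_mul, ENNReal.toReal_mul,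
    ENNReal.coe_toReal, NNReal.coe_rpow, coe_nnnorm, Real.norm_of_nonneg hr.le, sectionVol]

theorem isGreatest_sectionVol_of_vadd (hd : 2 ≤ d) {x : EuclideanSpace ℝ (Fin d)}
    (h : IsGreatest (range (sectionVol d (x +ᵥ S) u)) 1) :
    IsGreatest (range (sectionVol d S u)) 1 := by
  have hS : ∀ p, sectionVol d (x +ᵥ S) u (⟪x, u⟫ + p) = sectionVol d S u p := fun p => by
    simpa using sectionVol_vadd_smul (u := u) hd one_pos x S p
  obtain ⟨⟨p, hp⟩, hmax⟩ := h
  refine ⟨⟨p - ⟪x, u⟫, by rw [← hS, add_sub_cancel, hp]⟩, ?_⟩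
  rintro _ ⟨q, rfl⟩
  exact hmax ⟨_, hS q⟩

theorem eq_one_of_isGreatest_sectionVol (hd : 2 ≤ d) {r : ℝ} (hr : 0 < r)
    {x : EuclideanSpace ℝ (Fin d)} (hS : IsGreatest (range (sectionVol d S u)) 1)
    (h : IsGreatest (range (sectionVol d (x +ᵥ r • S) u)) 1) : r = 1 := by
  have hd' : (0 : ℝ) < d - 1 := by
    have : (2 : ℝ) ≤ d := by exact_mod_cast hd
    linarith
  obtain ⟨⟨p, hp⟩, hmax⟩ := hS
  obtain ⟨⟨q, hq⟩, hmax'⟩ := h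
  have h1 : r ^ ((d : ℝ) - 1) ≤ 1 := by
    have := hmax' ⟨_, sectionVol_vadd_smul hd hr x S p⟩
    rwa [hp, mul_one] at this
  have h2 : 1 ≤ r ^ ((d : ℝ) - 1) := by
    have := sectionVol_vadd_smul (u := u) hd hr x S ((q - ⟪x, u⟫) / r)
    rw [mul_div_cancel₀ _ hr.ne', add_sub_cancel, hq] at this
    exact this.le.trans (mul_le_of_le_one_right (by positivity) (hmax ⟨_, rfl⟩))
  exact (Real.rpow_left_inj hr.le zero_le_one hd'.ne').1 (by rw [h1.antisymm h2, Real.one_rpow])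

end Stretch

/-! ### Sufficiency of the equality conditions -/

section Sufficiency

variable {d : ℕ} {u v e : EuclideanSpace ℝ (Fin d)} {A B A' B' : Set (EuclideanSpace ℝ (Fin d))}
  {α β : ℝ}

theorem vadd_eq_singleton_add (x : EuclideanSpace ℝ (Fin d)) (A : Set (EuclideanSpace ℝ (Fin d))) :
    x +ᵥ A = {x} + A :=
  singleton_add.symm

theorem _root_.StretchOf.exists_eq_vadd {s : ℝ} (hs : s ≠ 0) (hv : v = s • e)
    (h : StretchOf A B v) :
    ∃ l : ℝ, 0 ≤ l ∧ ∃ ω : EuclideanSpace ℝ (Fin d), A = ω +ᵥ (B + l • segment ℝ 0 e) := by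
  obtain ⟨lam, hlam, w, rfl⟩ := h
  have key : ∀ (l : ℝ) (ω : EuclideanSpace ℝ (Fin d)),
      ω +ᵥ (B + l • segment ℝ 0 e) = B + segment ℝ ω (ω + l • e) := by
    intro l ω
    have h1 : l • segment ℝ 0 e = segment ℝ 0 (l • e) := by
      have := image_segment ℝ (l • LinearMap.id : EuclideanSpace ℝ (Fin d) →ₗ[ℝ] _).toAffineMap 0 e
      simpa using this
    have h2 : segment ℝ ω (ω + l • e) = {ω} + segment ℝ 0 (l • e) := by
      have := segment_translate_image ℝ ω 0 (l • e)
      rw [add_zero] at this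
      rw [← this, singleton_add]
    rw [vadd_eq_singleton_add, h2, h1, add_left_comm]
  rcases hs.lt_or_gt with hs | hs
  · refine ⟨lam * -s, mul_nonneg hlam (neg_nonneg.2 hs.le), w + lam • v, ?_⟩
    rw [key, segment_symm, hv]
    congr 2
    module
  · refine ⟨lam * s, mul_nonneg hlam hs.le, w, ?_⟩
    rw [key, hv, smul_smul]

theorem smul_vadd_add_segment_add (hA : Convex ℝ A) (hα : 0 ≤ α) (hβ : 0 ≤ β) (hαβ : α + β = 1)
    {l m : ℝ} (hl : 0 ≤ l) (hm : 0 ≤ m) (ω η : EuclideanSpace ℝ (Fin d)) :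
    α • (ω +ᵥ (A + l • segment ℝ 0 e)) + β • (η +ᵥ (A + m • segment ℝ 0 e)) =
      (α • ω + β • η) +ᵥ (A + (α * l + β * m) • segment ℝ 0 e) := by
  have hA' := hA.add_smul hα hβ
  rw [hαβ, one_smul] at hA'
  rw [(convex_segment (𝕜 := ℝ) 0 e).add_smul (mul_nonneg hα hl) (mul_nonneg hβ hm)]
  simp only [vadd_eq_singleton_add, smul_add, smul_set_singleton, smul_smul]
  rw [← singleton_add_singleton]
  nth_rewrite 3 [hA']
  abel

theorem volume_eq_of_homothetic (hd : 2 ≤ d) (hA : Convex ℝ A)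
    (hMA : IsGreatest (range (sectionVol d A u)) 1) (hMB : IsGreatest (range (sectionVol d B u)) 1)
    (hα : 0 ≤ α) (hβ : 0 ≤ β) (hαβ : α + β = 1) (h : Homothetic A B) :
    (volume (α • A + β • B)).toReal = α * (volume A).toReal + β * (volume B).toReal := by
  obtain ⟨r, hr, x, rfl⟩ := h
  obtain rfl := eq_one_of_isGreatest_sectionVol hd hr hMA hMB
  have := smul_vadd_add_smul_vadd hA hα hβ hαβ 0 x
  rw [zero_vadd] at this
  rw [one_smul, this, measure_vadd, measure_vadd, ← add_mul, hαβ, one_mul]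

theorem inner_ne_zero_of_image_eq {c : ℝ} (hA : (interior A).Nonempty) (hu : u ≠ 0)
    (h : (fun x => x - ⟪x, v⟫ • v) '' A = (fun x => x - ⟪x, v⟫ • v) '' (A ∩ {x | ⟪x, u⟫ = c})) :
    ⟪v, u⟫ ≠ 0 := by
  intro hvu
  have hsub : ∀ x ∈ A, ⟪x, u⟫ = c := by
    intro x hx
    obtain ⟨z, ⟨-, hz⟩, hzx⟩ := h ▸ mem_image_of_mem _ hx
    have := congrArg (fun y => ⟪y, u⟫) hzx
    simp only [inner_sub_left, real_inner_smul_left, hvu, mul_zero, sub_zero] at this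
    rw [← this]
    exact hz
  obtain ⟨x, hx⟩ := hA
  have hcont : Continuous fun t : ℝ => x + t • u := by fun_prop
  have hnhds : ∀ᶠ t in 𝓝 (0 : ℝ), x + t • u ∈ A :=
    hcont.continuousAt.eventually_mem (by simpa using mem_interior_iff_mem_nhds.1 hx)
  obtain ⟨t, ht, ht0⟩ := ((hnhds.filter_mono nhdsWithin_le_nhds).and
    (self_mem_nhdsWithin : {0}ᶜ ∈ 𝓝[≠] (0 : ℝ))).exists
  have h1 := hsub _ ht
  rw [inner_add_left, hsub x (interior_subset hx), real_inner_smul_left, add_eq_left] at h1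
  exact (mul_ne_zero ht0 (inner_self_ne_zero.2 hu)) h1

theorem add_smul_mem_of_image_eq {c : ℝ} (he : ⟪v, u⟫ ≠ 0)
    (h : (fun x => x - ⟪x, v⟫ • v) '' A = (fun x => x - ⟪x, v⟫ • v) '' (A ∩ {x | ⟪x, u⟫ = c})) :
    ∀ x ∈ A, x + (c - ⟪x, u⟫) • (⟪v, u⟫⁻¹ • v) ∈ A := by
  intro x hx
  obtain ⟨z, ⟨hzA, hz⟩, hzx⟩ := h ▸ mem_image_of_mem _ hx
  have hzx' : z = x + (⟪z, v⟫ - ⟪x, v⟫) • v := by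
    rw [sub_smul, ← add_sub_assoc, add_sub_right_comm, ← hzx]
    simp
  have hcu : c - ⟪x, u⟫ = (⟪z, v⟫ - ⟪x, v⟫) * ⟪v, u⟫ := by
    rw [← show ⟪z, u⟫ = c from hz]
    nth_rewrite 1 [hzx']
    rw [inner_add_left, real_inner_smul_left, add_sub_cancel_left]
  rwa [hcu, smul_smul, mul_inv_cancel_right₀ he, ← hzx']

theorem add_smul_mem_add_segment {c l : ℝ} (he : ⟪e, u⟫ = 1)
    (h : ∀ x ∈ A, x + (c - ⟪x, u⟫) • e ∈ A) :
    ∀ x ∈ A + l • segment ℝ 0 e, x + (c - ⟪x, u⟫) • e ∈ A := by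
  rintro _ ⟨x, hx, _, ⟨y, hy, rfl⟩, rfl⟩
  obtain ⟨t, -, rfl⟩ := (segment_eq_image' ℝ 0 e) ▸ hy
  convert h x hx using 1
  simp only [inner_add_left, real_inner_smul_left, he, sub_zero, zero_add]
  module

theorem isGreatest_sectionVol_of_eq_vadd_add_segment (hd : 2 ≤ d) (he : ⟪e, u⟫ = 1)
    (hA : IsCompact A) {c l : ℝ} {ω : EuclideanSpace ℝ (Fin d)}
    (hproj : ∀ x ∈ A, x + (c - ⟪x, u⟫) • e ∈ A)
    (h : IsGreatest (range (sectionVol d (ω +ᵥ (A + l • segment ℝ 0 e)) u)) 1) :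
    sectionVol d A u c = 1 ∧ IsGreatest (range (sectionVol d A u)) 1 := by
  refine isGreatest_sectionVol_of_forall_mem he hA ?_ ?_ (add_smul_mem_add_segment he hproj)
    (isGreatest_sectionVol_of_vadd hd h)
  · have : IsCompact (segment ℝ 0 e) := by
      rw [segment_eq_image']
      exact isCompact_Icc.image (by fun_prop)
    exact hA.add (this.smul l)
  · intro x hx
    exact ⟨x, hx, 0, ⟨0, left_mem_segment ℝ 0 e, by simp⟩, by simp⟩

theorem volume_eq_of_stretchOf (hd : 2 ≤ d) (hu : u ≠ 0)
    (hMA : IsGreatest (range (sectionVol d A u)) 1) (hMB : IsGreatest (range (sectionVol d B u)) 1)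
    (hα : 0 ≤ α) (hβ : 0 ≤ β) (hαβ : α + β = 1) {c : ℝ}
    (hA'c : IsCompact A') (hA'cv : Convex ℝ A') (hA'i : (interior A').Nonempty)
    (hAB' : Homothetic A' B')
    (h : (fun x => x - ⟪x, v⟫ • v) '' A' = (fun x => x - ⟪x, v⟫ • v) '' (A' ∩ {x | ⟪x, u⟫ = c}))
    (hA : StretchOf A A' v) (hB : StretchOf B B' v) :
    (volume (α • A + β • B)).toReal = α * (volume A).toReal + β * (volume B).toReal := by
  have hvu := inner_ne_zero_of_image_eq hA'i hu h
  have hproj := add_smul_mem_of_image_eq hvu h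
  have hv : v = ⟪v, u⟫ • (⟪v, u⟫⁻¹ • v) := (smul_inv_smul₀ hvu v).symm
  have he : ⟪⟪v, u⟫⁻¹ • v, u⟫ = 1 := by rw [real_inner_smul_left, inv_mul_cancel₀ hvu]
  obtain ⟨l, hl, ω, rfl⟩ := hA.exists_eq_vadd hvu hv
  obtain ⟨m, hm, η, rfl⟩ := hB.exists_eq_vadd hvu hv
  generalize ⟪v, u⟫⁻¹ • v = e at *
  obtain ⟨r, hr, x, rfl⟩ := hAB'
  obtain ⟨hc, hgA⟩ := isGreatest_sectionVol_of_eq_vadd_add_segment hd he hA'c hproj hMA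
  have hproj' : ∀ y ∈ x +ᵥ r • A', y + (⟪x, u⟫ + r * c - ⟪y, u⟫) • e ∈ x +ᵥ r • A' := by
    rintro _ ⟨_, ⟨z, hz, rfl⟩, rfl⟩
    refine ⟨_, ⟨_, hproj z hz, rfl⟩, ?_⟩
    simp only [vadd_eq_add, inner_add_left, real_inner_smul_left]
    module
  obtain ⟨-, hgB⟩ := isGreatest_sectionVol_of_eq_vadd_add_segment hd he
    ((hA'c.smul r).vadd x) hproj' hMB
  obtain rfl := eq_one_of_isGreatest_sectionVol hd hr hgA hgB
  have hx : η +ᵥ ((x +ᵥ (1 : ℝ) • A') + m • segment ℝ 0 e) =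
      (η + x) +ᵥ (A' + m • segment ℝ 0 e) := by
    simp only [one_smul, vadd_eq_singleton_add, ← singleton_add_singleton, add_assoc]
  obtain ⟨κ, hκ⟩ := exists_volume_add_segment he
  rw [hx, smul_vadd_add_segment_add hA'cv hα hβ hαβ hl hm, measure_vadd, measure_vadd, measure_vadd,
    hκ A' hA'c hA'cv c _ hl hproj, hκ A' hA'c hA'cv c _ hm hproj,
    hκ A' hA'c hA'cv c _ (by positivity) hproj, hc]
  linear_combination -(volume A').toReal * hαβ

end Sufficiency

end BonnesenSections

/-- Equality case of the Bonnesen inequality for sections (with the maximal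
section volumes of `A` and `B` parallel to `L = u^⊥` normalized to `1`, and
`α + β = 1`). -/
theorem bonnesen_sections_equality (d : ℕ) (hd : 2 ≤ d)
    (u : EuclideanSpace ℝ (Fin d)) (hu : ‖u‖ = 1)
    (A B : Set (EuclideanSpace ℝ (Fin d)))
    (hAc : IsCompact A) (hAcv : Convex ℝ A) (hAi : (interior A).Nonempty)
    (hBc : IsCompact B) (hBcv : Convex ℝ B) (hBi : (interior B).Nonempty)
    (hMA : IsGreatest (Set.range (sectionVol d A u)) 1)
    (hMB : IsGreatest (Set.range (sectionVol d B u)) 1)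
    (α β : ℝ) (hα : 0 < α) (hβ : 0 < β) (hαβ : α + β = 1) :
    (volume (α • A + β • B)).toReal =
        α * (volume A).toReal + β * (volume B).toReal ↔
      Homothetic A B ∨
        ∃ (v : EuclideanSpace ℝ (Fin d)) (A' B' : Set (EuclideanSpace ℝ (Fin d)))
          (c : ℝ), ‖v‖ = 1 ∧
          IsCompact A' ∧ Convex ℝ A' ∧ (interior A').Nonempty ∧
          IsCompact B' ∧ Convex ℝ B' ∧ (interior B').Nonempty ∧
          Homothetic A' B' ∧
          (fun x => x - ⟪x, v⟫ • v) '' A' =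
            (fun x => x - ⟪x, v⟫ • v) '' (A' ∩ {x | ⟪x, u⟫ = c}) ∧
          StretchOf A A' v ∧ StretchOf B B' v := by
  have hu0 : u ≠ 0 := norm_ne_zero_iff.1 (by simp [hu])
  constructor
  · intro h
    rcases BonnesenSections.homothetic_or_stretchOf_of_volume_eq hd hu hAc hAcv hAi hBc hBcv hMA hMB
      hα hβ hαβ h with ⟨x, hx⟩ | ⟨v, c, hv, ⟨hproj, hstretch⟩ | ⟨hproj, hstretch⟩⟩
    · exact Or.inl ⟨1, one_pos, x, by rw [one_smul, hx]⟩
    · exact Or.inr ⟨v, A, A, c, hv, hAc, hAcv, hAi, hAc, hAcv, hAi, ⟨1, one_pos, 0, by simp⟩, hproj,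
        BonnesenSections.stretchOf_refl A v, hstretch⟩
    · exact Or.inr ⟨v, B, B, c, hv, hBc, hBcv, hBi, hBc, hBcv, hBi, ⟨1, one_pos, 0, by simp⟩, hproj,
        hstretch, BonnesenSections.stretchOf_refl B v⟩
  · rintro (h | ⟨v, A', B', c, -, hA'c, hA'cv, hA'i, -, -, -, hAB', hproj, hA, hB⟩)
    · exact BonnesenSections.volume_eq_of_homothetic hd hAcv hMA hMB hα.le hβ.le hαβ h
    · exact BonnesenSections.volume_eq_of_stretchOf hd hu0 hMA hMB hα.le hβ.le hαβ hA'c hA'cv hA'i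
        hAB' hproj hA hB
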